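/- arXiv:0911.1737 — 2 statements merged into one kernel-verified Lean document; each statement's English description precedes it below -/
import Mathlib

section
/- Let R be a commutative ring, x, y, t ∈ R, and n a positive integer. For every integer k ≥ 2, the n×n determinant det_{0≤i,j≤n−1}(P_{j+1}(i,k) + t·(xy)^i·P_{j+1}(−i,k)) equals: (−1)^{k(n₁−1)−1}·(1+t)·t^{kn₁−2}·(xy)^{kn₁(2kn₁−k−3)+k}·P_{n−k+2,k}(x,y,t) if n = 2kn₁−1 for a positive integer n₁; (−1)^{kn₁+C(k,2)}·(1+t)·t^{k(n₁−1)}·(xy)^{k(n₁−1)(2kn₁−k+1)}·P_{n,k}(x,y,t) if n = 2kn₁−k+1; (−1)^{kn₁+C(k+1,2)}·(1+t)·t^{k(n₁−1)}·(xy)^{k(n₁−1)(2kn₁−k−1)}·P_{n−k,k}(x,y,t) if n = 2kn₁−k; (−1)^{kn₁}·(1+t)·t^{kn₁−1}·(xy)^{kn₁(2kn₁−k−1)}·P_{n,k}(x,y,t) if n = 2kn₁; and 0 if n is congruent to none of 0, k, k+1, 2k−1 modulo 2k. For k = 1, the determinant equals (−1)^{n₁+1}·(1+t)·t^{n₁−1}·(xy)^{2(n₁−1)²}·P_{n−1,1}(x,y,t)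 if n = 2n₁−1 and (−1)^{n₁}·(1+t)·t^{n₁−1}·(xy)^{2n₁(n₁−1)}·P_{n,1}(x,y,t) if n = 2n₁. For k = 0, det_{0≤i,j≤n−1}(P_{j+1}(i,0) + t·(xy)^i·P_{j+1}(−i,0)) = (1+t)^n·(xy)^{C(n,2)}·(x^n+y^n). -/
/-- `pgf x y n k` is the generating function `P_n(0,k)` of lattice paths from `(0,0)` to
`(n,k)` with steps `(1,1)`, `(1,0)`, `(1,-1)`, weighted `1`, `x+y`, `xy` respectively:
`P_n(0,k) = Σ_ℓ C(n,ℓ)·C(n,n−k−ℓ)·x^ℓ·y^{n−k−ℓ}`, the sum over integers `ℓ ≥ 0` with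
`n−k−ℓ ≥ 0` (terms with `ℓ > n` vanish since then `C(n,ℓ) = 0`).
`P_n(l,k)` is then `pgf x y n (k - l)`. -/
def pgf {R : Type*} [CommRing R] (x y : R) (n : ℕ) (k : ℤ) : R :=
  ∑ ℓ ∈ Finset.range (n + 1),
    if (ℓ : ℤ) ≤ (n : ℤ) - k then
      (n.choose ℓ : R) * (n.choose ((n : ℤ) - k - ℓ).toNat : R) *
        x ^ ℓ * y ^ ((n : ℤ) - k - ℓ).toNat
    else 0

/-- The polynomial `P_{m,k}(x,y,t)`:
`Σ_{s=0}^{m/k} (−1)^s t^{min(s, m/k−s)} x^{sk} y^{m−sk}` if `k ∣ m`, and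
`Σ_{s=0}^{⌊m/k⌋} (−1)^s t^{min(s, ⌈m/k⌉−s)} (x^{sk} y^{m−sk} + x^{m−sk} y^{sk})`
otherwise; `⌈m/k⌉` is written `(m+k−1)/k` in natural division. -/
def ppolyt {R : Type*} [CommRing R] (x y t : R) (m k : ℕ) : R :=
  if k ∣ m then
    ∑ s ∈ Finset.range (m / k + 1),
      (-1 : R) ^ s * t ^ min s (m / k - s) * (x ^ (s * k) * y ^ (m - s * k))
  else
    ∑ s ∈ Finset.range (m / k + 1),
      (-1 : R) ^ s * t ^ min s ((m + k - 1) / k - s) *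
        (x ^ (s * k) * y ^ (m - s * k) + x ^ (m - s * k) * y ^ (s * k))

/-- The matrix of Theorem 11, with `(i,j)`-entry
`P_{j+1}(i,k) + t·(xy)^i·P_{j+1}(−i,k)
  = pgf x y (j+1) (k−i) + t·(xy)^i·pgf x y (j+1) (k+i)`. -/
def thm11Matrix {R : Type*} [CommRing R] (x y t : R) (n : ℕ) (k : ℤ) :
    Matrix (Fin n) (Fin n) R :=
  Matrix.of fun i j =>
    pgf x y (j.1 + 1) (k - i.1) + t * (x * y) ^ (i.1 : ℕ) * pgf x y (j.1 + 1) (k + i.1)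

section PathGeneratingFunction

open Polynomial

variable {R : Type*} [CommRing R]

lemma coeff_one_add_C_mul_X_pow (x : R) (n m : ℕ) :
    ((1 + C x * X : R[X]) ^ n).coeff m = n.choose m * x ^ m := by
  have h : (1 + C x * X : R[X]) ^ n = ((1 + X : R[X]) ^ n).comp (C x * X) := by simp
  rw [h, comp_C_mul_X_coeff, coeff_one_add_X_pow]

lemma pgf_eq_coeff (x y : R) (n : ℕ) (k : ℤ) :
    pgf x y n k =
      if k ≤ n then (((1 + C x * X) * (1 + C y * X)) ^ n : R[X]).coeff (n - k).toNat else 0 := by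
  unfold pgf
  split_ifs with hk
  · obtain ⟨m, hm⟩ := Int.eq_ofNat_of_zero_le (sub_nonneg.mpr hk)
    rw [hm, Int.toNat_natCast, mul_pow, coeff_mul, Finset.Nat.sum_antidiagonal_eq_sum_range_succ_mk]
    simp only [coeff_one_add_C_mul_X_pow]
    have key : ∀ N, (N = n + 1 ∨ N = m + 1) → ∑ ℓ ∈ Finset.range N,
        (if (ℓ : ℤ) ≤ m then (n.choose ℓ : R) * (n.choose ((m : ℤ) - ℓ).toNat : R) *
          x ^ ℓ * y ^ ((m : ℤ) - ℓ).toNat else 0) =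
        ∑ ℓ ∈ Finset.range (max (n + 1) (m + 1)),
        (if (ℓ : ℤ) ≤ m then (n.choose ℓ : R) * (n.choose ((m : ℤ) - ℓ).toNat : R) *
          x ^ ℓ * y ^ ((m : ℤ) - ℓ).toNat else 0) := by
      intro N hN
      refine Finset.sum_subset (fun a ha => ?_) (fun a ha ha' => ?_)
      · simp only [Finset.mem_range] at *
        omega
      · simp only [Finset.mem_range] at *
        split_ifs with h
        · rw [Nat.choose_eq_zero_of_lt (by omega)]
          simp
        · rfl
    rw [key _ (Or.inl rfl), ← key _ (Or.inr rfl)]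
    refine Finset.sum_congr rfl fun ℓ hℓ => ?_
    have hℓ' : ℓ ≤ m := by simpa [Nat.lt_succ_iff] using hℓ
    rw [if_pos (by exact_mod_cast hℓ'), ← Nat.cast_sub hℓ', Int.toNat_natCast]
    ring
  · refine Finset.sum_eq_zero fun ℓ _ => if_neg ?_
    omega

lemma pgf_eq_zero (x y : R) {n : ℕ} {k : ℤ} (h : n < k) : pgf x y n k = 0 := by
  rw [pgf_eq_coeff, if_neg (by omega)]

lemma pgf_self (x y : R) (n : ℕ) : pgf x y n n = 1 := by
  simp [pgf_eq_coeff, coeff_zero_eq_eval_zero]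

lemma pgf_zero (x y : R) (k : ℤ) : pgf x y 0 k = if k = 0 then 1 else 0 := by
  rw [pgf_eq_coeff]
  simp only [pow_zero, coeff_one]
  split_ifs <;> first | rfl | omega

lemma pgf_succ (x y : R) (n : ℕ) (k : ℤ) :
    pgf x y (n + 1) k =
      pgf x y n (k - 1) + (x + y) * pgf x y n k + x * y * pgf x y n (k + 1) := by
  simp only [pgf_eq_coeff]
  set p : R[X] := ((1 + C x * X) * (1 + C y * X)) ^ n with hp
  have hq : ((1 + C x * X) * (1 + C y * X)) ^ (n + 1) =
      p + C (x + y) * (X * p) + C (x * y) * (X * (X * p)) := by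
    rw [pow_succ, ← hp, C_add, C_mul]
    ring
  rw [hq]
  push_cast
  rcases lt_or_ge ((n : ℤ) + 1) k with h | h
  · rw [if_neg (by omega), if_neg (by omega), if_neg (by omega), if_neg (by omega)]
    ring
  obtain ⟨m, hm⟩ := Int.eq_ofNat_of_zero_le (sub_nonneg.mpr h)
  have e1 : (n : ℤ) - (k - 1) = m := by omega
  have e2 : (n : ℤ) - k = (m : ℤ) - 1 := by omega
  have e3 : (n : ℤ) - (k + 1) = (m : ℤ) - 2 := by omega
  rw [if_pos h, if_pos (by omega), hm, e1, e2, e3, Int.toNat_natCast]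
  rcases m with _ | _ | m
  · rw [if_neg (by omega), if_neg (by omega)]
    simp
  · rw [if_pos (by omega), if_neg (by omega), coeff_add, coeff_add, coeff_C_mul, coeff_C_mul]
    simp
  · rw [if_pos (by omega), if_pos (by omega)]
    have e4 : (((m + 1 + 1 : ℕ) : ℤ) - 1).toNat = m + 1 := by omega
    have e5 : (((m + 1 + 1 : ℕ) : ℤ) - 2).toNat = m := by omega
    rw [e4, e5]
    simp only [coeff_add, coeff_C_mul, coeff_X_mul]

lemma pgf_neg (x y : R) (n m : ℕ) : pgf x y n (-m) = (x * y) ^ m * pgf x y n m := by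
  induction n generalizing m with
  | zero =>
    rw [pgf_zero, pgf_zero]
    rcases m with _ | m
    · simp
    · rw [if_neg (by omega), if_neg (by omega), mul_zero]
  | succ n ih =>
    rw [pgf_succ, pgf_succ]
    rcases m with _ | m
    · have h := ih 1
      simp only [Nat.cast_one, pow_one] at h
      simp [h]
    · have h1 := ih (m + 2)
      have h2 := ih (m + 1)
      have h3 := ih m
      have e1 : (-((m + 1 : ℕ) : ℤ) - 1) = -((m + 2 : ℕ) : ℤ) := by push_cast; ring
      have e2 : (-((m + 1 : ℕ) : ℤ) + 1) = -(m : ℤ) := by push_cast; ring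
      have e3 : (((m + 1 : ℕ) : ℤ) + 1) = ((m + 2 : ℕ) : ℤ) := by push_cast; ring
      have e4 : (((m + 1 : ℕ) : ℤ) - 1) = (m : ℤ) := by push_cast; ring
      rw [e1, e2, e3, e4, h1, h2, h3]
      ring

/-- The signed power sum `(-x)^m + (-y)^m`, halved at `m = 0`: the value at `z = -x` of the
Laurent polynomial `z^m + (x * y)^m * z^(-m)` (of `1` if `m = 0`). -/
def signedPowerSum (x y : R) (m : ℕ) : R :=
  if m = 0 then 1 else (-1) ^ m * (x ^ m + y ^ m)

lemma sum_signedPowerSum_mul (x y : R) (p : ℤ → R) (N : ℕ) :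
    ∑ v ∈ Finset.range (N + 2), signedPowerSum x y v *
        (p (v - 1) + (x + y) * p v + x * y * p (v + 1)) =
      p (-1) - x * y * p 1 + signedPowerSum x y (N + 1) * (x * y) * p (N + 2) -
        signedPowerSum x y (N + 2) * p (N + 1) := by
  induction N with
  | zero =>
    simp only [Finset.sum_range_succ, Finset.sum_range_zero, signedPowerSum]
    norm_num
    ring
  | succ N ih =>
    rw [Finset.sum_range_succ, ih]
    have e1 : ((N + 1 : ℕ) : ℤ) + 1 = N + 2 := by push_cast; ring
    have e2 : (N : ℤ) + 2 - 1 = N + 1 := by ring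
    have e3 : ((N + 2 : ℕ) : ℤ) = N + 2 := by push_cast; ring
    have e4 : ((N + 1 : ℕ) : ℤ) + 2 = N + 3 := by push_cast; ring
    rw [show N + 1 + 1 = N + 2 from rfl, show N + 1 + 2 = N + 3 from rfl]
    simp only [e1, e2, e3, e4, signedPowerSum]
    rw [show (N : ℤ) + 2 + 1 = N + 3 by ring]
    simp
    ring

lemma sum_signedPowerSum_mul_pgf (x y : R) {n j : ℕ} (hj : j ≤ n) :
    ∑ v ∈ Finset.range (n + 1), signedPowerSum x y v * pgf x y j v = if j = 0 then 1 else 0 := by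
  rcases j with _ | j
  · simp only [pgf_zero]
    rw [Finset.sum_eq_single 0]
    · simp [signedPowerSum]
    · intro b _ hb
      simp [hb]
    · simp
  · obtain ⟨n, rfl⟩ : ∃ N, n = N + 1 := ⟨n - 1, by omega⟩
    have h := sum_signedPowerSum_mul x y (pgf x y j) n
    rw [pgf_eq_zero x y (k := (n : ℤ) + 2) (by omega),
      pgf_eq_zero x y (k := (n : ℤ) + 1) (by omega)] at h
    have h1 := pgf_neg x y j 1
    simp only [Nat.cast_one, pow_one] at h1
    simp only [pgf_succ]
    rw [h, h1]
    simp

end PathGeneratingFunction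

section Determinants

open Matrix

/-- The top left `N × N` corner of an infinite matrix. -/
def corner {R : Type*} (G : ℕ → ℕ → R) (N : ℕ) : Matrix (Fin N) (Fin N) R :=
  Matrix.of fun i j => G i j

@[simp]
lemma corner_apply {R : Type*} (G : ℕ → ℕ → R) (N : ℕ) (i j : Fin N) : corner G N i j = G i j := rfl

variable {R : Type*} [CommRing R]

/-- If column operations with coefficients `Y` clear the bottom left block, the determinant is
the product of the determinants of the diagonal blocks. -/
lemma det_corner_add (G Y : ℕ → ℕ → R) (a b : ℕ)
    (h : ∀ i < b, ∀ v < a,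
      G (a + i) v + ∑ w ∈ Finset.range b, G (a + i) (a + w) * Y w v = 0) :
    (corner G (a + b)).det =
      (corner (fun i v => G i v + ∑ w ∈ Finset.range b, G i (a + w) * Y w v) a).det *
        (corner (fun i w => G (a + i) (a + w)) b).det := by
  have h1 : (corner G (a + b)).submatrix finSumFinEquiv finSumFinEquiv =
      fromBlocks (corner G a) (Matrix.of fun (i : Fin a) (w : Fin b) => G i (a + w))
        (Matrix.of fun (i : Fin b) (v : Fin a) => G (a + i) v)
        (corner (fun i w => G (a + i) (a + w)) b) := by
    ext (i | i) (j | j) <;> simp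
  have h2 : fromBlocks (corner G a) (Matrix.of fun (i : Fin a) (w : Fin b) => G i (a + w))
        (Matrix.of fun (i : Fin b) (v : Fin a) => G (a + i) v)
        (corner (fun i w => G (a + i) (a + w)) b) *
      fromBlocks 1 0 (Matrix.of fun (w : Fin b) (v : Fin a) => Y w v) 1 =
      fromBlocks (corner (fun i v => G i v + ∑ w ∈ Finset.range b, G i (a + w) * Y w v) a)
        (Matrix.of fun (i : Fin a) (w : Fin b) => G i (a + w)) 0
        (corner (fun i w => G (a + i) (a + w)) b) := by
    rw [fromBlocks_multiply]
    simp only [Matrix.mul_one, Matrix.mul_zero, zero_add]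
    congr 1
    · ext i j
      simp [Matrix.mul_apply, Finset.sum_range]
    · ext i j
      simpa [Matrix.mul_apply, Finset.sum_range] using h i i.2 j j.2
  rw [← det_submatrix_equiv_self finSumFinEquiv, h1, ← det_fromBlocks_zero₂₁ _
    (Matrix.of fun (i : Fin a) (w : Fin b) => G i (a + w)), ← h2, det_mul, det_fromBlocks_zero₁₂]
  simp

lemma coe_finRotate_pow {N : ℕ} (s : ℕ) (j : Fin N) :
    (((finRotate N) ^ s) j : ℕ) = (j + s) % N := by
  rcases N with _ | N
  · exact j.elim0
  · induction s with
    | zero => simp [Nat.mod_eq_of_lt j.2]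
    | succ s ih =>
      rw [pow_succ', Equiv.Perm.mul_apply, finRotate_apply, Fin.val_add, ih, ← add_assoc]
      simp

lemma det_corner_rotate (G : ℕ → ℕ → R) (N s : ℕ) :
    (corner G N).det = (-1) ^ ((N - 1) * s) * (corner (fun i j => G i ((j + s) % N)) N).det := by
  have h := det_permute' ((finRotate N) ^ s) (corner G N)
  have h2 : (corner G N).submatrix id ((finRotate N) ^ s) =
      corner (fun i j => G i ((j + s) % N)) N := by
    ext i j
    simp [coe_finRotate_pow]
  rw [h2, map_pow] at h
  rw [h]
  rcases N with _ | N
  · simp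
  · rw [sign_finRotate]
    push_cast
    rw [← mul_assoc, ← pow_mul, ← pow_add, Even.neg_one_pow, one_mul]
    exact ⟨_, rfl⟩

lemma sign_revPerm (N : ℕ) :
    Equiv.Perm.sign (Fin.revPerm : Equiv.Perm (Fin N)) = (-1) ^ N.choose 2 := by
  induction N with
  | zero => simp [Subsingleton.elim (Fin.revPerm : Equiv.Perm (Fin 0)) 1]
  | succ N ih =>
    have h : (finRotate (N + 1)) * (Fin.revPerm : Equiv.Perm (Fin (N + 1))) =
        Equiv.Perm.decomposeFin.symm (0, Fin.revPerm) := by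
      ext j
      refine Fin.cases ?_ (fun j => ?_) j
      · simp [Equiv.Perm.mul_apply]
      · simp [Equiv.Perm.mul_apply, Fin.rev_succ]
    have h1 := congrArg Equiv.Perm.sign h
    rw [Equiv.Perm.sign_mul, sign_finRotate, Equiv.Perm.decomposeFin.symm_sign, ih] at h1
    rw [Nat.choose_succ_succ' N 1, pow_add, Nat.choose_one_right]
    simp only [if_true, one_mul] at h1
    rw [← h1, ← mul_assoc, ← pow_add, Even.neg_one_pow, one_mul]
    exact ⟨N, rfl⟩

lemma det_corner_reverse (G : ℕ → ℕ → R) (N : ℕ) :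
    (corner G N).det = (-1) ^ N.choose 2 * (corner (fun i j => G i (N - 1 - j)) N).det := by
  have h := det_permute' Fin.revPerm (corner G N)
  have h2 : (corner G N).submatrix id Fin.revPerm = corner (fun i j => G i (N - 1 - j)) N := by
    ext i j
    simp only [submatrix_apply, corner_apply, Fin.revPerm_apply, Fin.val_rev, id]
    congr 1
    omega
  rw [h2, sign_revPerm] at h
  rw [h]
  push_cast
  rw [← mul_assoc, ← pow_add, Even.neg_one_pow, one_mul]
  exact ⟨_, rfl⟩

lemma det_corner_of_upperTriangular (G : ℕ → ℕ → R) (N : ℕ)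
    (h : ∀ i j, j < i → i < N → G i j = 0) :
    (corner G N).det = ∏ i ∈ Finset.range N, G i i := by
  rw [det_of_isUpperTriangular, Finset.prod_range]
  · rfl
  · intro i j hij
    exact h i j hij i.2

/-- Adding a multiple of column `j` to column `0` does not change the determinant. -/
lemma det_corner_add_mul_col (G : ℕ → ℕ → R) (N : ℕ) (c : R) {j : ℕ} (hj : 0 < j) (hjN : j < N) :
    (corner G N).det = (corner (fun i v => if v = 0 then G i 0 + c * G i j else G i v) N).det := by
  have hne : (⟨0, by omega⟩ : Fin N) ≠ ⟨j, hjN⟩ := by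
    simp [Fin.ext_iff, hj.ne]
  rw [← det_updateCol_add_smul_self (corner G N) hne c]
  congr 1
  ext i v
  by_cases hv : v = ⟨0, by omega⟩
  · subst hv
    simp
  · have : (v : ℕ) ≠ 0 := fun h => hv (Fin.ext h)
    simp [updateCol_ne hv, this]

end Determinants

section BorderedMatrix

open Matrix

variable {R : Type*} [CommRing R]

/-- The coefficient of `g_v` in `g_{k-i} + t * q^i * g_{k+i}` when `g_{-m} = q^m * g_m`. -/
def reflRow (q t : R) (k i v : ℕ) : R :=
  (if v = (i - k) + (k - i) then q ^ (i - k) else 0) + if v = k + i then t * q ^ i else 0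

/-- The rows `reflRow q t k i` bordered from above by `e`. -/
def borderedRows (q t : R) (k : ℕ) (e : ℕ → R) : ℕ → ℕ → R
  | 0, v => e v
  | i + 1, v => reflRow q t k i v

/-- The determinant of the first `n` rows `reflRow q t k i` bordered by `e`. -/
def borderedDet (q t : R) (k : ℕ) (e : ℕ → R) (n : ℕ) : R :=
  (corner (borderedRows q t k e) (n + 1)).det

lemma sum_reflRow_mul_pgf (x y t : R) (k i : ℕ) {n j : ℕ} (hj : j ≤ n) :
    ∑ v ∈ Finset.range (n + 1), reflRow (x * y) t k i v * pgf x y j v =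
      pgf x y j (k - i) + t * (x * y) ^ i * pgf x y j (k + i) := by
  simp only [reflRow, add_mul, Finset.sum_add_distrib, ite_mul, zero_mul, Finset.sum_ite_eq',
    Finset.mem_range]
  congr 1
  · have h : (x * y) ^ (i - k) * pgf x y j ((i - k) + (k - i) : ℕ) = pgf x y j (k - i) := by
      rcases le_total i k with h | h
      · rw [Nat.sub_eq_zero_of_le h, zero_add, pow_zero, one_mul, Nat.cast_sub h]
      · rw [Nat.sub_eq_zero_of_le h, add_zero, ← pgf_neg, Nat.cast_sub h, neg_sub]
    split_ifs with h1
    · exact h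
    · rw [← h, pgf_eq_zero x y (by omega), mul_zero]
  · split_ifs with h1
    · push_cast
      rfl
    · rw [pgf_eq_zero x y (by omega), mul_zero]

theorem det_thm11Matrix_eq_borderedDet (x y t : R) (n k : ℕ) :
    (thm11Matrix x y t n k).det = borderedDet (x * y) t k (signedPowerSum x y) n := by
  have hU : (corner (fun v j => pgf x y j v) (n + 1)).det = 1 := by
    rw [det_corner_of_upperTriangular]
    · simp [pgf_self]
    · intro i j hij _
      exact pgf_eq_zero x y (by exact_mod_cast hij)
  rw [borderedDet, ← mul_one (corner (borderedRows _ _ _ _) _).det, ← hU, ← det_mul,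
    det_succ_row_zero,
    Finset.sum_eq_single 0]
  · have h0 : (corner (borderedRows (x * y) t k (signedPowerSum x y)) (n + 1) *
        corner (fun v j => pgf x y j v) (n + 1)) 0 0 = 1 := by
      have := sum_signedPowerSum_mul_pgf x y (Nat.zero_le n)
      rw [Finset.sum_range] at this
      simpa [Matrix.mul_apply, borderedRows] using this
    rw [h0]
    simp only [Fin.val_zero, pow_zero, one_mul]
    congr 1
    ext i j
    have := sum_reflRow_mul_pgf x y t k i (n := n) (j := j + 1) (by omega)
    rw [Finset.sum_range] at this
    simpa [Matrix.mul_apply, borderedRows, thm11Matrix] using this.symm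
  · intro j _ hj
    have := sum_signedPowerSum_mul_pgf x y (j := j) (n := n) (by omega)
    rw [Finset.sum_range, if_neg (fun h : (j : ℕ) = 0 => hj (Fin.ext h))] at this
    have h0 : (corner (borderedRows (x * y) t k (signedPowerSum x y)) (n + 1) *
        corner (fun v j => pgf x y j v) (n + 1)) 0 j = 0 := by
      simpa [Matrix.mul_apply, borderedRows] using this
    rw [h0]
    ring
  · simp

end BorderedMatrix

section Reduction

variable {K : Type*} [Field K]

/-- The coefficients expressing the last `2 * k` coordinates of a vector of length `m + 1 + 2 * k`
annihilated by the rows `reflRow q t k i`, `m ≤ i < m + 2 * k`, through its first `m + 1` ones. -/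
def reflExtension (q t : K) (k m w v : ℕ) : K :=
  if k ≤ w + 1 ∧ v = (m + 1 + w - k - k) + (k - (m + 1 + w - k)) then
    -(q ^ (m + 1 + w - k - k) / (t * q ^ (m + 1 + w - k))) else 0

/-- The border obtained from `e` by eliminating the last `2 * k` columns. -/
def foldBorder (q t : K) (k m : ℕ) (e : ℕ → K) (v : ℕ) : K :=
  e v + ∑ w ∈ Finset.range (2 * k), e (m + 1 + w) * reflExtension q t k m w v

lemma sum_reflRow_mul_reflExtension_of_lt (q t : K) {k m i : ℕ} (hi : i < m) (v : ℕ) :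
    ∑ w ∈ Finset.range (2 * k), reflRow q t k i (m + 1 + w) * reflExtension q t k m w v = 0 := by
  refine Finset.sum_eq_zero fun w _ => ?_
  by_cases hw : k ≤ w + 1
  · rw [reflRow, if_neg (by omega), if_neg (by omega)]
    simp
  · rw [reflExtension, if_neg (fun h => hw h.1), mul_zero]

lemma sum_reflRow_mul_reflExtension {q t : K} (hq : q ≠ 0) (ht : t ≠ 0) {k m i v : ℕ}
    (hk : 0 < k) (hmi : m ≤ i) (hi : i < m + 2 * k) (hv : v ≤ m) :
    ∑ w ∈ Finset.range (2 * k), reflRow q t k i (m + 1 + w) * reflExtension q t k m w v =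
      -reflRow q t k i v := by
  by_cases hik : i ≤ m + k
  · rw [Finset.sum_eq_single (i + k - m - 1)]
    · have e1 : m + 1 + (i + k - m - 1) = i + k := by omega
      rw [reflExtension, e1, Nat.add_sub_cancel]
      by_cases hvd : v = (i - k) + (k - i)
      · rw [if_pos ⟨by omega, hvd⟩]
        simp only [reflRow]
        rw [if_neg (by omega), if_pos (by omega), if_pos hvd, if_neg (by omega)]
        field_simp
        ring
      · rw [if_neg (fun h => hvd h.2), mul_zero, reflRow, if_neg hvd, if_neg (by omega)]
        simp
    · intro w _ hw
      by_cases hwk : k ≤ w + 1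
      · rw [reflRow, if_neg (by omega), if_neg (by omega)]
        simp
      · rw [reflExtension, if_neg (fun h => hwk h.1), mul_zero]
    · intro h
      rw [Finset.mem_range] at h
      omega
  · rw [reflRow, if_neg (by omega), if_neg (by omega), add_zero, neg_zero]
    refine Finset.sum_eq_zero fun w hw => ?_
    rw [Finset.mem_range] at hw
    by_cases hwk : k ≤ w + 1
    · rw [reflRow, if_neg (by omega), if_neg (by omega)]
      simp
    · rw [reflExtension, if_neg (fun h => hwk h.1), mul_zero]

lemma prod_reflRow_diag {R : Type*} [CommRing R] (q t : R) (m k : ℕ) :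
    (∏ i ∈ Finset.range (k + 1), (t * q ^ (m + (i + 1)))) * ∏ j ∈ Finset.range k, q ^ (m + 1 + j) =
      t ^ (k + 1) * q ^ ((2 * k + 1) * m + (k + 1) ^ 2) := by
  induction k with
  | zero => simp
  | succ k ih =>
    rw [Finset.prod_range_succ, Finset.prod_range_succ (fun j => q ^ (m + 1 + j)) k]
    linear_combination (t * q ^ (m + (k + 1 + 1)) * q ^ (m + 1 + k)) * ih

lemma det_reflRow_block {R : Type*} [CommRing R] (q t : R) (m k : ℕ) :
    (corner (fun i w => reflRow q t (k + 1) (m + i) (m + 1 + w)) (2 * (k + 1))).det =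
      (-1) ^ k * (if m = 0 then 1 + t else t) * t ^ (k + 1) *
        q ^ (2 * (k + 1) * m + (k + 1) ^ 2) := by
  rw [det_corner_rotate _ _ k, det_corner_of_upperTriangular]
  · have hsign : (-1 : R) ^ ((2 * (k + 1) - 1) * k) = (-1) ^ k := by
      rw [show (2 * (k + 1) - 1) * k = 2 * (k * k) + k by
        rw [show 2 * (k + 1) - 1 = 2 * k + 1 by omega]; ring, pow_add, pow_mul]
      simp
    have h0 : reflRow q t (k + 1) m (m + 1 + k) = (if m = 0 then 1 + t else t) * q ^ m := by
      rw [reflRow, if_pos (show m + 1 + k = k + 1 + m by omega)]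
      by_cases hm : m = 0
      · subst hm
        simp [add_comm]
      · rw [if_neg (by omega), if_neg hm, zero_add]
    have h1 : ∀ i ∈ Finset.range (k + 1),
        reflRow q t (k + 1) (m + (i + 1)) (m + 1 + (i + 1 + k) % (2 * (k + 1))) =
          t * q ^ (m + (i + 1)) := by
      intro i hi
      rw [Finset.mem_range] at hi
      rw [Nat.mod_eq_of_lt (by omega), reflRow, if_neg (by omega), if_pos (by omega), zero_add]
    have h2 : ∀ j ∈ Finset.range k,
        reflRow q t (k + 1) (m + (k + 2 + j)) (m + 1 + (k + 2 + j + k) % (2 * (k + 1))) =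
          q ^ (m + 1 + j) := by
      intro j hj
      rw [Finset.mem_range] at hj
      have e : (k + 2 + j + k) % (2 * (k + 1)) = j := by
        rw [show k + 2 + j + k = j + 2 * (k + 1) by ring, Nat.add_mod_right,
          Nat.mod_eq_of_lt (by omega)]
      rw [e, reflRow, if_pos (by omega), if_neg (by omega), add_zero]
      congr 1
      omega
    have h3 := prod_reflRow_diag q t m k
    rw [hsign, show 2 * (k + 1) = k + 2 + k by ring, Finset.prod_range_add,
      Finset.prod_range_succ', show k + 2 + k = 2 * (k + 1) by ring, Finset.prod_congr rfl h1,
      Finset.prod_congr rfl h2, add_zero, zero_add, Nat.mod_eq_of_lt (by omega), h0,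
      show 2 * (k + 1) * m + (k + 1) ^ 2 = m + ((2 * k + 1) * m + (k + 1) ^ 2) by ring,
      pow_add q m]
    linear_combination ((-1) ^ k * (if m = 0 then 1 + t else t) * q ^ m) * h3
  · intro i j hji hi
    rcases lt_or_ge (j + k) (2 * (k + 1)) with h | h
    · rw [Nat.mod_eq_of_lt h, reflRow, if_neg (by omega), if_neg (by omega), add_zero]
    · rw [Nat.mod_eq_sub_mod h, Nat.mod_eq_of_lt (by omega), reflRow, if_neg (by omega),
        if_neg (by omega), add_zero]

theorem borderedDet_add_two_mul {q t : K} (hq : q ≠ 0) (ht : t ≠ 0) (k m : ℕ) (e : ℕ → K) :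
    borderedDet q t (k + 1) e (m + 2 * (k + 1)) =
      (-1) ^ k * (if m = 0 then 1 + t else t) * t ^ (k + 1) *
        q ^ (2 * (k + 1) * m + (k + 1) ^ 2) *
        borderedDet q t (k + 1) (foldBorder q t (k + 1) m e) m := by
  unfold borderedDet
  rw [show m + 2 * (k + 1) + 1 = m + 1 + 2 * (k + 1) by ring,
    det_corner_add _ (reflExtension q t (k + 1) m) (m + 1) (2 * (k + 1)), mul_comm,
    ← det_reflRow_block]
  · congr 2
    · ext i w
      rw [corner_apply, show m + 1 + (i : ℕ) = m + i + 1 by ring]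
      rfl
    · ext ⟨i, hi⟩ v
      rw [corner_apply]
      rcases i with _ | i
      · rfl
      · simp only [borderedRows, corner_apply]
        rw [sum_reflRow_mul_reflExtension_of_lt q t (by omega), add_zero]
  · intro i hi v hv
    rw [show m + 1 + (i : ℕ) = m + i + 1 by ring]
    simp only [borderedRows]
    rw [sum_reflRow_mul_reflExtension hq ht (by omega) (by omega) (by omega) (by omega),
      add_neg_cancel]

lemma foldBorder_of_add_lt (q t : K) {k m v : ℕ} (e : ℕ → K) (h : v + k < m) :
    foldBorder q t k m e v = e v := by
  rw [foldBorder, Finset.sum_eq_zero, add_zero]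
  intro w _
  rw [reflExtension, if_neg (by omega), mul_zero]

lemma foldBorder_of_le {q t : K} (hq : q ≠ 0) {k m v : ℕ} (hk : 0 < k) (e : ℕ → K)
    (hvm : v ≤ m) (h : m ≤ v + k) (h' : v = 0 ∨ k < v + m) :
    foldBorder q t k m e v = e v - e (v + 2 * k) / (t * q ^ k) := by
  rw [foldBorder, Finset.sum_eq_single (v + 2 * k - m - 1)]
  · rw [reflExtension, if_pos (by omega), show m + 1 + (v + 2 * k - m - 1) - k = v + k by omega,
      show m + 1 + (v + 2 * k - m - 1) = v + 2 * k by omega, Nat.add_sub_cancel, pow_add]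
    field_simp
    ring
  · intro w _ hw
    rw [reflExtension, if_neg (by omega), mul_zero]
  · intro hw
    rw [Finset.mem_range] at hw
    omega

/-- The alternating sum `∑ j ≤ N, (-τ)^(N - j) * e (v + d * j)`, by Horner's rule. -/
def alternatingHorner (τ : K) (e : ℕ → K) (v d : ℕ) : ℕ → K
  | 0 => e v
  | N + 1 => -τ * alternatingHorner τ e v d N + e (v + d * (N + 1))

lemma alternatingHorner_congr (τ : K) {e e' : ℕ → K} {v d N : ℕ}
    (h : ∀ j ≤ N, e (v + d * j) = e' (v + d * j)) :
    alternatingHorner τ e v d N = alternatingHorner τ e' v d N := by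
  induction N with
  | zero => exact h 0 le_rfl
  | succ N ih =>
    rw [alternatingHorner, alternatingHorner, ih fun j hj => h j (by omega), h (N + 1) le_rfl]

lemma alternatingHorner_foldBorder {q t : K} (hq : q ≠ 0) (ht : t ≠ 0) {k r v : ℕ} (hk : 0 < k)
    (e : ℕ → K) (hvr : v ≤ r) (hr : r ≤ v + k) (h : v = 0 ∨ k < v + r) (N : ℕ) :
    alternatingHorner (t * q ^ k) (foldBorder q t k (r + 2 * k * N) e) v (2 * k) N =
      -(alternatingHorner (t * q ^ k) e v (2 * k) (N + 1) / (t * q ^ k)) := by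
  have hτ : t * q ^ k ≠ 0 := mul_ne_zero ht (pow_ne_zero _ hq)
  have hlast : foldBorder q t k (r + 2 * k * N) e (v + 2 * k * N) =
      e (v + 2 * k * N) - e (v + 2 * k * (N + 1)) / (t * q ^ k) := by
    rw [foldBorder_of_le hq hk e (by omega) (by omega), show v + 2 * k * N + 2 * k =
      v + 2 * k * (N + 1) by ring]
    rcases N with _ | N
    · simpa using h
    · right
      nlinarith
  rcases N with _ | N
  · rw [alternatingHorner, alternatingHorner, alternatingHorner]
    simp only [mul_zero, add_zero] at hlast ⊢
    rw [hlast]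
    field_simp
    ring
  · rw [alternatingHorner, hlast, alternatingHorner_congr (e' := e), alternatingHorner,
      alternatingHorner]
    · field_simp
      ring
    · intro j hj
      refine foldBorder_of_add_lt q t e ?_
      nlinarith

end Reduction

section BaseCases

variable {R : Type*} [CommRing R]

lemma borderedDet_zero_right (q t : R) (k : ℕ) (e : ℕ → R) : borderedDet q t k e 0 = e 0 := by
  simp [borderedDet, borderedRows]

theorem borderedDet_zero_left (q t : R) (e : ℕ → R) (n : ℕ) :
    borderedDet q t 0 e n = (-1) ^ n * e n * (1 + t) ^ n * q ^ n.choose 2 := by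
  have hcol : ∀ p < n, (p + 1 + n) % (n + 1) = p := fun p hp => by
    rw [show p + 1 + n = p + (n + 1) by ring, Nat.add_mod_right, Nat.mod_eq_of_lt (by omega)]
  rw [borderedDet, det_corner_rotate _ _ n, det_corner_of_upperTriangular]
  · have h : ∀ i ∈ Finset.range n,
        borderedRows q t 0 e (i + 1) ((i + 1 + n) % (n + 1)) = (1 + t) * q ^ i := by
      intro i hi
      rw [hcol i (Finset.mem_range.mp hi)]
      simp [borderedRows, reflRow, add_mul]
    rw [Finset.prod_range_succ', Finset.prod_congr rfl h, Finset.prod_mul_distrib,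
      Finset.prod_const, Finset.card_range, Finset.prod_pow_eq_pow_sum, Finset.sum_range_id,
      ← Nat.choose_two_right, zero_add, Nat.mod_eq_of_lt (by omega), Nat.add_sub_cancel]
    have hsign : (-1 : R) ^ (n * n) = (-1) ^ n := by
      rw [pow_mul]
      rcases Nat.even_or_odd n with hn | hn
      · simp [hn.neg_one_pow]
      · simp [hn.neg_one_pow]
    rw [hsign, borderedRows]
    ring
  · intro i j hji hi
    obtain ⟨i, rfl⟩ : ∃ i', i = i' + 1 := ⟨i - 1, by omega⟩
    rcases j with _ | j
    · rw [zero_add, Nat.mod_eq_of_lt (by omega), borderedRows, reflRow, if_neg (by omega),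
        if_neg (by omega), add_zero]
    · rw [hcol j (by omega), borderedRows, reflRow, if_neg (by omega), if_neg (by omega), add_zero]

lemma borderedDet_of_lt (q t : R) {k n : ℕ} (e : ℕ → R) (hn : 0 < n) (hnk : n < k) :
    borderedDet q t k e n = 0 := by
  refine Matrix.det_eq_zero_of_row_eq_zero ⟨1, by omega⟩ fun j => ?_
  simp only [corner_apply, borderedRows]
  rw [reflRow, if_neg (by omega), if_neg (by omega), add_zero]

lemma borderedDet_of_lt_of_lt (q t : R) {k n : ℕ} (e : ℕ → R) (hkn : k + 1 < n)
    (hn : n + 1 < 2 * k) : borderedDet q t k e n = 0 := by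
  have hne : (⟨k + 2, by omega⟩ : Fin (n + 1)) ≠ ⟨k, by omega⟩ := by simp
  rw [borderedDet, ← Matrix.det_updateRow_add_smul_self _ hne (-q)]
  refine Matrix.det_eq_zero_of_row_eq_zero ⟨k + 2, by omega⟩ fun j => ?_
  obtain ⟨k, rfl⟩ : ∃ k', k = k' + 1 := ⟨k - 1, by omega⟩
  simp only [Matrix.updateRow_self, Pi.add_apply, Pi.smul_apply, corner_apply, borderedRows,
    smul_eq_mul]
  rw [reflRow, reflRow, if_neg (show ¬(j : ℕ) = k + 1 + (k + 1 + 1) by omega),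
    if_neg (show ¬(j : ℕ) = k + 1 + k by omega)]
  have e1 : k + 1 + 1 - (k + 1) = 1 := by omega
  have e2 : k + 1 - (k + 1 + 1) = 0 := by omega
  have e3 : k - (k + 1) = 0 := by omega
  have e4 : k + 1 - k = 1 := by omega
  rw [e1, e2, e3, e4]
  split_ifs <;> first | omega | simp

theorem borderedDet_self (q t : R) (k : ℕ) (e : ℕ → R) :
    borderedDet q t (k + 1) e (k + 1) = (-1) ^ (k + 1).choose 2 * (1 + t) * e 0 := by
  have hrow : ∀ i < k + 1, ∀ j < k + 1, reflRow q t (k + 1) i (1 + (k + 1 - 1 - j)) =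
      if i = j then (if i = 0 then 1 + t else 1) else 0 := by
    intro i hi j hj
    rw [reflRow, show i - (k + 1) = 0 by omega, pow_zero]
    by_cases hij : i = j
    · subst hij
      by_cases h0 : i = 0
      · subst h0
        rw [if_pos (by omega), if_pos (by omega)]
        simp
      · rw [if_pos (by omega), if_neg (by omega)]
        simp [h0]
    · rw [if_neg (by omega), if_neg (by omega), if_neg hij, add_zero]
  rw [borderedDet, show k + 1 + 1 = 1 + (k + 1) by ring, det_corner_add _ (fun _ _ => 0),
    det_corner_reverse _ (k + 1), det_corner_of_upperTriangular _ (k + 1)]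
  · have h : ∀ i ∈ Finset.range k,
        borderedRows q t (k + 1) e (1 + (i + 1)) (1 + (k + 1 - 1 - (i + 1))) = 1 := by
      intro i hi
      rw [Finset.mem_range] at hi
      rw [add_comm 1 (i + 1), borderedRows, hrow _ (by omega) _ (by omega)]
      simp
    have h0 : borderedRows q t (k + 1) e (1 + 0) (1 + (k + 1 - 1 - 0)) = 1 + t := by
      rw [add_comm 1 0, borderedRows, hrow _ (by omega) _ (by omega)]
      simp
    rw [Finset.prod_range_succ', Finset.prod_congr rfl h, h0]
    simp [borderedRows]
    ring
  · intro i j hji hi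
    rw [add_comm 1 i, borderedRows, hrow _ hi _ (by omega), if_neg (by omega)]
  · intro i hi v hv
    obtain rfl : v = 0 := by omega
    rw [add_comm 1 i, borderedRows, reflRow, if_neg (by omega), if_neg (by omega)]
    simp

theorem borderedDet_succ (q t : R) (k : ℕ) (e : ℕ → R) :
    borderedDet q t (k + 2) e (k + 3) =
      (-1) ^ (k + 4).choose 2 * (1 + t) * (e (k + 3) - t * q * e (k + 1)) := by
  rw [borderedDet, det_corner_reverse, det_corner_add_mul_col _ _ (-(t * q)) two_pos (by omega),
    det_corner_of_upperTriangular]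
  · have h : ∀ i ∈ Finset.range (k + 2), (if i + 1 + 1 = 0 then
        borderedRows q t (k + 2) e (i + 1 + 1) (k + 3 + 1 - 1 - 0) +
          -(t * q) * borderedRows q t (k + 2) e (i + 1 + 1) (k + 3 + 1 - 1 - 2) else
        borderedRows q t (k + 2) e (i + 1 + 1) (k + 3 + 1 - 1 - (i + 1 + 1))) = 1 := by
      intro i hi
      rw [Finset.mem_range] at hi
      rw [if_neg (by omega), borderedRows, reflRow, if_pos (by omega), if_neg (by omega),
        show i + 1 - (k + 2) = 0 by omega]
      simp
    rw [Finset.prod_range_succ', Finset.prod_range_succ', Finset.prod_congr rfl h]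
    simp [borderedRows, reflRow]
    ring
  · intro i j hji hi
    obtain ⟨i, rfl⟩ : ∃ i', i = i' + 1 := ⟨i - 1, by omega⟩
    simp only [borderedRows]
    split_ifs with hj
    · rw [reflRow, reflRow, if_neg (by omega),
        if_neg (show ¬ k + 3 + 1 - 1 - 2 = k + 2 + i by omega)]
      by_cases h1 : i = 1
      · subst h1
        rw [if_pos (by omega), if_pos (by omega), show 1 - (k + 2) = 0 by omega]
        simp
      · rw [if_neg (by omega), if_neg (by omega)]
        simp
    · rw [reflRow, if_neg (by omega), if_neg (by omega), add_zero]

theorem borderedDet_two_mul_sub_one {K : Type*} [Field K] {q t : K} (hq : q ≠ 0) (ht : t ≠ 0)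
    (k : ℕ) (e : ℕ → K) :
    borderedDet q t (k + 2) e (2 * k + 3) =
      (-1) ^ k * (1 + t) * t ^ k * q ^ (k * (k + 2)) * (e (k + 3) - t * q * e (k + 1)) := by
  have hlt : ∀ p < k + 3, (p + (k + 1)) % (2 * k + 3 + 1) = p + (k + 1) := fun p hp =>
    Nat.mod_eq_of_lt (by omega)
  have hge : ∀ j < k + 1, (k + 3 + j + (k + 1)) % (2 * k + 3 + 1) = j := fun j hj => by
    rw [show k + 3 + j + (k + 1) = j + (2 * k + 3 + 1) by ring, Nat.add_mod_right,
      Nat.mod_eq_of_lt (by omega)]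
  rw [borderedDet, det_corner_rotate _ _ (k + 1),
    det_corner_add_mul_col _ _ (-(t * q)⁻¹) two_pos (by omega), det_corner_of_upperTriangular]
  · rw [show 2 * k + 3 + 1 = k + 3 + (k + 1) by ring, Finset.prod_range_add,
      Finset.prod_range_succ', Finset.prod_range_succ',
      show k + 3 + (k + 1) = 2 * k + 3 + 1 by ring]
    simp only [Nat.add_eq_zero_iff, one_ne_zero, and_false, if_false, if_true, zero_add,
      OfNat.ofNat_ne_zero, false_and]
    have h1 : ∀ i ∈ Finset.range (k + 1),
        borderedRows q t (k + 2) e (i + 1 + 1) ((i + 1 + 1 + (k + 1)) % (2 * k + 3 + 1)) =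
          t * q ^ (0 + (i + 1)) := by
      intro i hi
      rw [Finset.mem_range] at hi
      rw [hlt _ (by omega), borderedRows, reflRow, if_neg (by omega), if_pos (by omega), zero_add,
        zero_add]
    have h2 : ∀ j ∈ Finset.range (k + 1),
        borderedRows q t (k + 2) e (k + 3 + j) ((k + 3 + j + (k + 1)) % (2 * k + 3 + 1)) =
          q ^ j := by
      intro j hj
      rw [Finset.mem_range] at hj
      rw [hge _ hj, show k + 3 + j = k + 2 + j + 1 by ring, borderedRows, reflRow,
        if_pos (by omega), if_neg (by omega), add_zero, Nat.add_sub_cancel_left]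
    have h3 := prod_reflRow_diag q t 0 k
    have h4 : borderedRows q t (k + 2) e 1 ((1 + (k + 1)) % (2 * k + 3 + 1)) = 1 + t := by
      rw [hlt _ (by omega)]
      simp [borderedRows, reflRow, add_comm 1 (k + 1)]
    have h5 : ∏ j ∈ Finset.range (k + 1), q ^ j = ∏ j ∈ Finset.range k, q ^ (0 + 1 + j) := by
      rw [Finset.prod_range_succ', pow_zero, mul_one]
      exact Finset.prod_congr rfl fun j _ => by rw [zero_add, add_comm]
    have hsign : (-1 : K) ^ ((2 * k + 3 + 1 - 1) * (k + 1)) = (-1) ^ (k + 1) := by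
      rw [show (2 * k + 3 + 1 - 1) * (k + 1) = 2 * ((k + 1) * (k + 1)) + (k + 1) by
        rw [Nat.add_sub_cancel]; ring, pow_add, pow_mul]
      simp
    have h6 := hlt 0 (by omega)
    have h7 := hlt 2 (by omega)
    rw [zero_add] at h6
    rw [Finset.prod_congr rfl h1, Finset.prod_congr rfl h2, h4, h5, hsign, h6, h7,
      show 2 + (k + 1) = k + 3 by ring]
    simp only [borderedRows]
    have h8 : t * q * (t * q)⁻¹ = 1 := mul_inv_cancel₀ (mul_ne_zero ht hq)
    calc _ = (-1) ^ (k + 1) * (1 + t) * (e (k + 1) + -(t * q)⁻¹ * e (k + 3)) *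
          ((∏ i ∈ Finset.range (k + 1), t * q ^ (0 + (i + 1))) *
            ∏ j ∈ Finset.range k, q ^ (0 + 1 + j)) := by ring
      _ = _ := by
        rw [h3]
        linear_combination ((-1) ^ k * (1 + t) * t ^ k * q ^ (k * (k + 2)) * e (k + 3)) * h8
  · intro i j hji hi
    obtain ⟨i, rfl⟩ : ∃ i', i = i' + 1 := ⟨i - 1, by omega⟩
    simp only [borderedRows]
    split_ifs with hj
    · rw [hlt _ (by omega), hlt _ (by omega), reflRow, reflRow,
        if_neg (show ¬ 0 + (k + 1) = k + 2 + i by omega)]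
      by_cases h1 : i = 1
      · subst h1
        rw [if_pos (by omega), if_neg (by omega), if_pos (by omega),
          show 1 - (k + 2) = 0 by omega]
        field_simp
        simp
      · rw [if_neg (by omega), if_neg (by omega), if_neg (by omega)]
        simp
    · rcases lt_or_ge j (k + 3) with h | h
      · rw [hlt _ h, reflRow, if_neg (by omega), if_neg (by omega), add_zero]
      · obtain ⟨j, rfl⟩ := Nat.exists_eq_add_of_le h
        rw [hge _ (by omega), reflRow, if_neg (by omega), if_neg (by omega), add_zero]

end BaseCases

section Iteration

/-- The scalar by which `borderedDet` changes from `m` to `m + 2 * (k + 1)`. -/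
def foldFactor {R : Type*} [CommRing R] (q t : R) (k m : ℕ) : R :=
  (-1) ^ (k + 1) * (if m = 0 then 1 + t else t) * t ^ k * q ^ (2 * (k + 1) * m + (k + 1) * k)

lemma prod_foldFactor_of_pos {R : Type*} [CommRing R] (q t : R) (k : ℕ) {r : ℕ} (hr : 0 < r)
    (N a : ℕ) (ha : a + N * (k + 1) * (k + 2) = N * (k + 1) * (2 * r + 2 * (k + 1) * N)) :
    ∏ j ∈ Finset.range N, foldFactor q t k (r + 2 * (k + 1) * j) =
      (-1) ^ ((k + 1) * N) * t ^ ((k + 1) * N) * q ^ a := by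
  have h : ∀ j ∈ Finset.range N, foldFactor q t k (r + 2 * (k + 1) * j) =
      (-1) ^ (k + 1) * t ^ (k + 1) * q ^ (2 * (k + 1) * (r + 2 * (k + 1) * j) + (k + 1) * k) := by
    intro j _
    rw [foldFactor, if_neg (by omega)]
    ring
  have hsum : ∀ M, ∑ j ∈ Finset.range M, (2 * (k + 1) * (r + 2 * (k + 1) * j) + (k + 1) * k) +
      M * (k + 1) * (k + 2) = M * (k + 1) * (2 * r + 2 * (k + 1) * M) := by
    intro M
    induction M with
    | zero => simp
    | succ M ih =>
      rw [Finset.sum_range_succ]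
      linarith
  rw [Finset.prod_congr rfl h, Finset.prod_mul_distrib, Finset.prod_const, Finset.card_range,
    Finset.prod_pow_eq_pow_sum, mul_pow, ← pow_mul, ← pow_mul]
  congr 2
  have := hsum N
  omega

lemma prod_foldFactor_zero {R : Type*} [CommRing R] (q t : R) (k N a : ℕ)
    (ha : a + (N + 1) * (k + 1) * (k + 2) =
      (N + 1) * (k + 1) * (2 * (k + 1) * (N + 1))) :
    ∏ j ∈ Finset.range (N + 1), foldFactor q t k (0 + 2 * (k + 1) * j) =
      (-1) ^ ((k + 1) * (N + 1)) * (1 + t) * t ^ ((k + 1) * (N + 1) - 1) * q ^ a := by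
  obtain rfl : a = N * (k + 1) * (3 * k + 2 + 2 * (k + 1) * N) + (k + 1) * k :=
    Nat.add_right_cancel (ha.trans (by ring))
  have h := prod_foldFactor_of_pos q t k (r := 2 * (k + 1)) (by omega) N
    (N * (k + 1) * (3 * k + 2 + 2 * (k + 1) * N)) (by ring)
  have h' : ∀ j ∈ Finset.range N, foldFactor q t k (0 + 2 * (k + 1) * (j + 1)) =
      foldFactor q t k (2 * (k + 1) + 2 * (k + 1) * j) := fun j _ => by
    congr 1
    ring
  rw [Finset.prod_range_succ', Finset.prod_congr rfl h', h, foldFactor, if_pos (by simp),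
    show (k + 1) * (N + 1) - 1 = (k + 1) * N + k by
      rw [show (k + 1) * (N + 1) = (k + 1) * N + k + 1 by ring, Nat.add_sub_cancel]]
  ring

variable {K : Type*} [Field K]

theorem borderedDet_add_mul {q t : K} (hq : q ≠ 0) (ht : t ≠ 0) {k r v w : ℕ} {α β : K}
    (hv : v ≤ r) (hv' : r ≤ v + (k + 1)) (hv'' : v = 0 ∨ k + 1 < v + r)
    (hw : w ≤ r) (hw' : r ≤ w + (k + 1)) (hw'' : w = 0 ∨ k + 1 < w + r)
    (h : ∀ e, borderedDet q t (k + 1) e r = α * e v + β * e w) (N : ℕ) (e : ℕ → K) :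
    borderedDet q t (k + 1) e (r + 2 * (k + 1) * N) =
      (∏ j ∈ Finset.range N, foldFactor q t k (r + 2 * (k + 1) * j)) *
        (α * alternatingHorner (t * q ^ (k + 1)) e v (2 * (k + 1)) N +
          β * alternatingHorner (t * q ^ (k + 1)) e w (2 * (k + 1)) N) := by
  induction N generalizing e with
  | zero => simp [h, alternatingHorner]
  | succ N ih =>
    rw [show r + 2 * (k + 1) * (N + 1) = r + 2 * (k + 1) * N + 2 * (k + 1) by ring,
      borderedDet_add_two_mul hq ht, ih, Finset.prod_range_succ,
      alternatingHorner_foldBorder hq ht (by omega : 0 < k + 1) e hv hv' hv'',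
      alternatingHorner_foldBorder hq ht (by omega : 0 < k + 1) e hw hw' hw'', foldFactor]
    generalize (if r + 2 * (k + 1) * N = 0 then 1 + t else t) = s
    generalize r + 2 * (k + 1) * N = m
    field_simp
    ring

theorem borderedDet_add_mul_eq_zero {q t : K} (hq : q ≠ 0) (ht : t ≠ 0) {k r : ℕ}
    (h : ∀ e, borderedDet q t (k + 1) e r = 0) (N : ℕ) (e : ℕ → K) :
    borderedDet q t (k + 1) e (r + 2 * (k + 1) * N) = 0 := by
  induction N generalizing e with
  | zero => simp [h]
  | succ N ih =>
    rw [show r + 2 * (k + 1) * (N + 1) = r + 2 * (k + 1) * N + 2 * (k + 1) by ring,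
      borderedDet_add_two_mul hq ht, ih, mul_zero]

end Iteration

section Polynomials

variable {R : Type*} [CommRing R]

lemma ppolyt_mul_add_two (x y t : R) {k : ℕ} (hk : 0 < k) (M : ℕ) :
    ppolyt x y t (k * (M + 2)) k =
      (-1) ^ M * x ^ (k * (M + 2)) + y ^ (k * (M + 2)) -
        t * (x * y) ^ k * ppolyt x y t (k * M) k := by
  rw [ppolyt, ppolyt, if_pos (dvd_mul_right _ _), if_pos (dvd_mul_right _ _),
    Nat.mul_div_cancel_left _ hk, Nat.mul_div_cancel_left _ hk, Finset.sum_range_succ,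
    Finset.sum_range_succ', Finset.mul_sum]
  have h : ∀ s ∈ Finset.range (M + 1), (-1 : R) ^ (s + 1) * t ^ min (s + 1) (M + 2 - (s + 1)) *
      (x ^ ((s + 1) * k) * y ^ (k * (M + 2) - (s + 1) * k)) =
      -(t * (x * y) ^ k * ((-1) ^ s * t ^ min s (M - s) *
        (x ^ (s * k) * y ^ (k * M - s * k)))) := by
    intro s hs
    have hs' : s ≤ M := by simpa [Nat.lt_succ_iff] using hs
    obtain ⟨c, rfl⟩ := Nat.exists_eq_add_of_le hs'
    rw [show min (s + 1) (s + c + 2 - (s + 1)) = min s (s + c - s) + 1 by omega,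
      show k * (s + c + 2) - (s + 1) * k = k * c + k by
        rw [show k * (s + c + 2) = k * c + k + (s + 1) * k by ring, Nat.add_sub_cancel],
      show k * (s + c) - s * k = k * c by
        rw [show k * (s + c) = k * c + s * k by ring, Nat.add_sub_cancel]]
    ring
  rw [Finset.sum_congr rfl h, Finset.sum_neg_distrib]
  rw [show M + 1 + 1 = M + 2 from rfl, mul_comm (M + 2) k, Nat.sub_self, Nat.sub_self]
  simp
  ring

lemma ppolyt_mul_add_one_add_two (x y t : R) {k : ℕ} (hk : 2 ≤ k) (M : ℕ) :
    ppolyt x y t (k * (M + 2) + 1) k =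
      x ^ (k * (M + 2) + 1) + y ^ (k * (M + 2) + 1) +
        (-1) ^ M * t * (x * y) * (x ^ (k * (M + 2) - 1) + y ^ (k * (M + 2) - 1)) -
        t * (x * y) ^ k * ppolyt x y t (k * M + 1) k := by
  have hdvd : ∀ L, ¬ k ∣ k * L + 1 := fun L h => by
    have := (Nat.dvd_add_right (dvd_mul_right k L)).mp h
    exact absurd (Nat.le_of_dvd one_pos this) (by omega)
  have hdiv : ∀ L, (k * L + 1) / k = L := fun L => by
    rw [Nat.mul_add_div (by omega), Nat.div_eq_of_lt (by omega), add_zero]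
  have hceil : ∀ L, (k * L + 1 + k - 1) / k = L + 1 := fun L => by
    rw [show k * L + 1 + k - 1 = k * (L + 1) by rw [mul_add]; omega,
      Nat.mul_div_cancel_left _ (by omega)]
  rw [ppolyt, ppolyt, if_neg (hdvd _), if_neg (hdvd _), hdiv, hdiv, hceil, hceil,
    Finset.sum_range_succ, Finset.sum_range_succ', Finset.mul_sum]
  have h : ∀ s ∈ Finset.range (M + 1),
      (-1 : R) ^ (s + 1) * t ^ min (s + 1) (M + 2 + 1 - (s + 1)) *
        (x ^ ((s + 1) * k) * y ^ (k * (M + 2) + 1 - (s + 1) * k) +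
          x ^ (k * (M + 2) + 1 - (s + 1) * k) * y ^ ((s + 1) * k)) =
      -(t * (x * y) ^ k * ((-1) ^ s * t ^ min s (M + 1 - s) *
        (x ^ (s * k) * y ^ (k * M + 1 - s * k) + x ^ (k * M + 1 - s * k) * y ^ (s * k)))) := by
    intro s hs
    have hs' : s ≤ M := by simpa [Nat.lt_succ_iff] using hs
    obtain ⟨c, rfl⟩ := Nat.exists_eq_add_of_le hs'
    rw [show min (s + 1) (s + c + 2 + 1 - (s + 1)) = min s (s + c + 1 - s) + 1 by omega,
      show k * (s + c + 2) + 1 - (s + 1) * k = k * c + k + 1 by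
        rw [show k * (s + c + 2) + 1 = k * c + k + 1 + (s + 1) * k by ring, Nat.add_sub_cancel],
      show k * (s + c) + 1 - s * k = k * c + 1 by
        rw [show k * (s + c) + 1 = k * c + 1 + s * k by ring, Nat.add_sub_cancel]]
    ring
  rw [Finset.sum_congr rfl h, Finset.sum_neg_distrib]
  have e1 : k * (M + 2) + 1 - (M + 1 + 1) * k = 1 := by
    rw [mul_comm k, Nat.add_sub_cancel_left]
  have e2 : min (M + 1 + 1) (M + 2 + 1 - (M + 1 + 1)) = 1 := by omega
  obtain ⟨c, hc⟩ : ∃ c, k * (M + 2) = c + 1 := ⟨k * (M + 2) - 1, by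
    have : 0 < k * (M + 2) := by positivity
    omega⟩
  rw [e1, e2, mul_comm (M + 1 + 1) k, show M + 1 + 1 = M + 2 from rfl, hc, Nat.add_sub_cancel]
  simp
  ring

lemma alternatingHorner_signedPowerSum_zero {K : Type*} [Field K] (x y t : K) {k : ℕ}
    (hk : 0 < k) (N : ℕ) :
    alternatingHorner (t * (x * y) ^ k) (signedPowerSum x y) 0 (2 * k) N =
      ppolyt x y t (2 * k * N) k := by
  induction N with
  | zero => simp [alternatingHorner, signedPowerSum, ppolyt]
  | succ N ih =>
    rw [alternatingHorner, ih, show 2 * k * (N + 1) = k * (2 * N + 2) by ring,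
      ppolyt_mul_add_two x y t hk, show k * (2 * N) = 2 * k * N by ring, signedPowerSum,
      if_neg (by positivity), zero_add, Even.neg_one_pow ⟨k * (N + 1), by ring⟩,
      Even.neg_one_pow (even_two_mul N)]
    ring

lemma alternatingHorner_signedPowerSum_sub {K : Type*} [Field K] (x y t : K) (k N : ℕ) :
    alternatingHorner (t * (x * y) ^ (k + 2)) (signedPowerSum x y) (k + 3) (2 * (k + 2)) N -
        t * (x * y) *
          alternatingHorner (t * (x * y) ^ (k + 2)) (signedPowerSum x y) (k + 1)
            (2 * (k + 2)) N =
      (-1) ^ (k + 1) * ppolyt x y t ((k + 2) * (2 * N + 1) + 1) (k + 2) := by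
  induction N with
  | zero =>
    have hdvd : ¬ k + 2 ∣ k + 2 + 1 := fun h => by
      have := (Nat.dvd_add_right (dvd_refl (k + 2))).mp h
      exact absurd (Nat.le_of_dvd one_pos this) (by omega)
    have hdiv : (k + 2 + 1) / (k + 2) = 1 := by
      rw [Nat.add_div_left _ (by omega), Nat.div_eq_of_lt (by omega)]
    have hceil : (k + 2 + 1 + (k + 2) - 1) / (k + 2) = 2 := by
      rw [show k + 2 + 1 + (k + 2) - 1 = 2 * (k + 2) by omega, Nat.mul_div_cancel _ (by omega)]
    rw [alternatingHorner, alternatingHorner, mul_zero, zero_add, mul_one, ppolyt, if_neg hdvd,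
      hdiv, hceil, signedPowerSum, signedPowerSum, if_neg (by omega), if_neg (by omega)]
    simp [Finset.sum_range_succ]
    ring
  | succ N ih =>
    have hsign : ∀ c, (-1 : K) ^ (c + 2 * (k + 2) * (N + 1)) = (-1) ^ c := fun c => by
      rw [pow_add, (Even.neg_one_pow ⟨(k + 2) * (N + 1), by ring⟩ :
        (-1 : K) ^ (2 * (k + 2) * (N + 1)) = 1), mul_one]
    have hodd : (-1 : K) ^ (2 * N + 1) = -1 := Odd.neg_one_pow ⟨N, rfl⟩
    rw [show 2 * (N + 1) + 1 = 2 * N + 1 + 2 by ring, ppolyt_mul_add_one_add_two x y t (by omega),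
      alternatingHorner, alternatingHorner, signedPowerSum, signedPowerSum, if_neg (by omega),
      if_neg (by omega), hsign, hsign, hodd,
      show k + 3 + 2 * (k + 2) * (N + 1) = (k + 2) * (2 * N + 1 + 2) + 1 by ring,
      show k + 1 + 2 * (k + 2) * (N + 1) = (k + 2) * (2 * N + 1 + 2) - 1 by
        rw [show (k + 2) * (2 * N + 1 + 2) = k + 1 + 2 * (k + 2) * (N + 1) + 1 by ring,
          Nat.add_sub_cancel]]
    linear_combination -(t * (x * y) ^ (k + 2)) * ih

end Polynomials

section Transfer

variable {R S : Type*} [CommRing R] [CommRing S]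

lemma map_pgf (f : R →+* S) (x y : R) (n : ℕ) (k : ℤ) :
    f (pgf x y n k) = pgf (f x) (f y) n k := by
  simp only [pgf, map_sum, apply_ite f, map_mul, map_pow, map_natCast, map_zero]

lemma map_ppolyt (f : R →+* S) (x y t : R) (m k : ℕ) :
    f (ppolyt x y t m k) = ppolyt (f x) (f y) (f t) m k := by
  simp only [ppolyt, apply_ite f, map_sum, map_mul, map_add, map_pow, map_neg, map_one]

lemma map_det_thm11Matrix (f : R →+* S) (x y t : R) (n : ℕ) (k : ℤ) :
    f (thm11Matrix x y t n k).det = (thm11Matrix (f x) (f y) (f t) n k).det := by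
  rw [RingHom.map_det]
  congr 1
  ext i j
  simp [thm11Matrix, map_pgf]

/-- An evaluation of the determinant valid at nonzero elements of every field is valid in every
commutative ring. -/
theorem det_thm11Matrix_of_field {n : ℕ} {k : ℤ} {z : ℤ} {a b m j : ℕ}
    (h : ∀ (K : Type) [Field K] (x y t : K), x ≠ 0 → y ≠ 0 → t ≠ 0 →
      (thm11Matrix x y t n k).det = z * (1 + t) * t ^ a * (x * y) ^ b * ppolyt x y t m j)
    (x y t : R) :
    (thm11Matrix x y t n k).det = z * (1 + t) * t ^ a * (x * y) ^ b * ppolyt x y t m j := by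
  let P := MvPolynomial (Fin 3) ℤ
  let X : Fin 3 → P := MvPolynomial.X
  let ι : P →+* FractionRing P := algebraMap P (FractionRing P)
  have hι : Function.Injective ι := IsFractionRing.injective P (FractionRing P)
  have hX : ∀ i, ι (X i) ≠ 0 := fun i =>
    (map_ne_zero_iff ι hι).mpr (MvPolynomial.X_ne_zero i)
  have key : (thm11Matrix (X 0) (X 1) (X 2) n k).det =
      z * (1 + X 2) * X 2 ^ a * (X 0 * X 1) ^ b * ppolyt (X 0) (X 1) (X 2) m j := by
    apply hι
    rw [map_det_thm11Matrix, h _ _ _ _ (hX 0) (hX 1) (hX 2)]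
    simp only [map_mul, map_add, map_pow, map_one, map_intCast, map_ppolyt]
  let φ : P →+* R := MvPolynomial.eval₂Hom (Int.castRingHom R) ![x, y, t]
  have hφ : φ (X 0) = x ∧ φ (X 1) = y ∧ φ (X 2) = t :=
    ⟨MvPolynomial.eval₂Hom_X' _ _ _, MvPolynomial.eval₂Hom_X' _ _ _,
      MvPolynomial.eval₂Hom_X' _ _ _⟩
  have := congrArg φ key
  simpa only [map_det_thm11Matrix, map_mul, map_add, map_pow, map_one, map_intCast, map_ppolyt,
    hφ.1, hφ.2.1, hφ.2.2] using this

end Transfer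

section Evaluations

variable {R : Type*} [CommRing R]

theorem det_thm11Matrix_of_eq_two_mul (x y t : R) (k N a : ℕ)
    (ha : a + (N + 1) * (k + 1) * (k + 2) = (N + 1) * (k + 1) * (2 * (k + 1) * (N + 1))) :
    (thm11Matrix x y t (2 * (k + 1) * (N + 1)) ((k + 1 : ℕ) : ℤ)).det =
      ((-1) ^ ((k + 1) * (N + 1)) : ℤ) * (1 + t) * t ^ ((k + 1) * (N + 1) - 1) * (x * y) ^ a *
        ppolyt x y t (2 * (k + 1) * (N + 1)) (k + 1) := by
  refine det_thm11Matrix_of_field (fun K _ x y t hx hy ht => ?_) x y t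
  have h := borderedDet_add_mul (q := x * y) (mul_ne_zero hx hy) ht (k := k) (r := 0) (v := 0)
    (w := 0) (α := 1) (β := 0) le_rfl (by omega) (Or.inl rfl) le_rfl (by omega) (Or.inl rfl)
    (fun e => by rw [borderedDet_zero_right]; ring) (N + 1) (signedPowerSum x y)
  rw [det_thm11Matrix_eq_borderedDet, ← zero_add (2 * (k + 1) * (N + 1)), h,
    prod_foldFactor_zero _ _ _ _ a ha, alternatingHorner_signedPowerSum_zero x y t k.succ_pos,
    zero_add]
  push_cast
  ring

theorem det_thm11Matrix_of_eq_two_mul_add_self (x y t : R) (k N a : ℕ)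
    (ha : a + N * (k + 1) * (k + 2) = N * (k + 1) * (2 * (k + 1) + 2 * (k + 1) * N)) :
    (thm11Matrix x y t (k + 1 + 2 * (k + 1) * N) ((k + 1 : ℕ) : ℤ)).det =
      ((-1) ^ ((k + 1) * N + (k + 1).choose 2) : ℤ) * (1 + t) * t ^ ((k + 1) * N) * (x * y) ^ a *
        ppolyt x y t (2 * (k + 1) * N) (k + 1) := by
  refine det_thm11Matrix_of_field (fun K _ x y t hx hy ht => ?_) x y t
  have h := borderedDet_add_mul (q := x * y) (mul_ne_zero hx hy) ht (k := k) (r := k + 1) (v := 0)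
    (w := 0) (α := (-1) ^ ((k + 1).choose 2) * (1 + t)) (β := 0) (by omega) (by omega)
    (Or.inl rfl) (by omega) (by omega) (Or.inl rfl)
    (fun e => by rw [borderedDet_self]; ring) N (signedPowerSum x y)
  rw [det_thm11Matrix_eq_borderedDet, h, prod_foldFactor_of_pos _ _ _ (by omega) _ a ha,
    alternatingHorner_signedPowerSum_zero x y t k.succ_pos]
  push_cast
  ring

theorem det_thm11Matrix_of_eq_two_mul_add_succ (x y t : R) (k N a : ℕ)
    (ha : a + N * (k + 2) * (k + 3) = N * (k + 2) * (2 * (k + 3) + 2 * (k + 2) * N)) :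
    (thm11Matrix x y t (k + 3 + 2 * (k + 2) * N) ((k + 2 : ℕ) : ℤ)).det =
      ((-1) ^ ((k + 2) * (N + 1) + (k + 2).choose 2) : ℤ) * (1 + t) * t ^ ((k + 2) * N) *
        (x * y) ^ a * ppolyt x y t (k + 3 + 2 * (k + 2) * N) (k + 2) := by
  refine det_thm11Matrix_of_field (fun K _ x y t hx hy ht => ?_) x y t
  have h := borderedDet_add_mul (q := x * y) (mul_ne_zero hx hy) ht (k := k + 1) (r := k + 3)
    (v := k + 3) (w := k + 1) (α := (-1) ^ ((k + 4).choose 2) * (1 + t))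
    (β := -((-1) ^ ((k + 4).choose 2) * (1 + t) * (t * (x * y)))) le_rfl (by omega)
    (Or.inr (by omega)) (by omega) (by omega) (Or.inr (by omega))
    (fun e => by rw [borderedDet_succ]; ring) N (signedPowerSum x y)
  have hH := alternatingHorner_signedPowerSum_sub x y t k N
  have hc : (k + 4).choose 2 = (k + 2).choose 2 + (2 * k + 5) := by
    rw [Nat.choose_succ_succ' (k + 3) 1, Nat.choose_succ_succ' (k + 2) 1, Nat.choose_one_right,
      Nat.choose_one_right]
    ring
  rw [det_thm11Matrix_eq_borderedDet, h, prod_foldFactor_of_pos _ _ _ (by omega) _ a ha,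
    show k + 3 + 2 * (k + 2) * N = (k + 2) * (2 * N + 1) + 1 by ring, hc, pow_add,
    Odd.neg_one_pow (⟨k + 2, by ring⟩ : Odd (2 * k + 5))]
  push_cast
  linear_combination (-1) ^ ((k + 2) * N) * t ^ ((k + 2) * N) * (x * y) ^ a *
    (-1) ^ ((k + 2).choose 2) * (-1) * (1 + t) * hH

theorem det_thm11Matrix_of_eq_two_mul_sub_one (x y t : R) (k N a : ℕ)
    (ha : a + N * (k + 2) * (k + 3) = N * (k + 2) * (2 * (2 * k + 3) + 2 * (k + 2) * N)) :
    (thm11Matrix x y t (2 * k + 3 + 2 * (k + 2) * N) ((k + 2 : ℕ) : ℤ)).det =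
      ((-1) ^ ((k + 2) * N + 1) : ℤ) * (1 + t) * t ^ ((k + 2) * N + k) *
        (x * y) ^ (a + k * (k + 2)) * ppolyt x y t ((k + 2) * (2 * N + 1) + 1) (k + 2) := by
  refine det_thm11Matrix_of_field (fun K _ x y t hx hy ht => ?_) x y t
  have hq := mul_ne_zero hx hy
  have h := borderedDet_add_mul (q := x * y) hq ht (k := k + 1) (r := 2 * k + 3)
    (v := k + 3) (w := k + 1) (α := (-1) ^ k * (1 + t) * t ^ k * (x * y) ^ (k * (k + 2)))
    (β := -((-1) ^ k * (1 + t) * t ^ k * (x * y) ^ (k * (k + 2)) * (t * (x * y))))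
    (by omega) (by omega)
    (Or.inr (by omega)) (by omega) (by omega) (Or.inr (by omega))
    (fun e => by rw [borderedDet_two_mul_sub_one hq ht]; ring) N (signedPowerSum x y)
  have hH := alternatingHorner_signedPowerSum_sub x y t k N
  have hs : (-1 : K) ^ k * (-1) ^ k = 1 := by rw [← mul_pow]; simp
  rw [det_thm11Matrix_eq_borderedDet, h, prod_foldFactor_of_pos _ _ _ (by omega) _ a ha]
  push_cast
  linear_combination (-1) ^ ((k + 2) * N) * t ^ ((k + 2) * N) * (x * y) ^ a *
    ((-1) ^ k * (1 + t) * t ^ k * (x * y) ^ (k * (k + 2))) * hH -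
    (-1) ^ ((k + 2) * N) * t ^ ((k + 2) * N) * (x * y) ^ a * ((1 + t) * t ^ k *
      (x * y) ^ (k * (k + 2))) * ppolyt x y t ((k + 2) * (2 * N + 1) + 1) (k + 2) * hs

theorem det_thm11Matrix_eq_zero (x y t : R) (k n : ℕ) (h0 : n % (2 * (k + 1)) ≠ 0)
    (h1 : n % (2 * (k + 1)) ≠ k + 1) (h2 : n % (2 * (k + 1)) ≠ k + 2)
    (h3 : n % (2 * (k + 1)) ≠ 2 * k + 1) :
    (thm11Matrix x y t n ((k + 1 : ℕ) : ℤ)).det = 0 := by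
  have key := det_thm11Matrix_of_field (n := n) (k := ((k + 1 : ℕ) : ℤ)) (z := 0) (a := 0)
    (b := 0) (m := 0) (j := 0) (fun K _ x y t hx hy ht => ?_) x y t
  · simpa using key
  rw [det_thm11Matrix_eq_borderedDet, ← Nat.mod_add_div n (2 * (k + 1)),
    borderedDet_add_mul_eq_zero (mul_ne_zero hx hy) ht]
  · simp
  intro e
  have hlt := Nat.mod_lt n (by omega : 2 * (k + 1) > 0)
  rcases lt_or_ge (n % (2 * (k + 1))) (k + 1) with h | h
  · exact borderedDet_of_lt _ _ _ (by omega) h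
  · exact borderedDet_of_lt_of_lt _ _ _ (by omega) (by omega)

theorem det_thm11Matrix_zero (x y t : R) {n : ℕ} (hn : 0 < n) :
    (thm11Matrix x y t n 0).det = (1 + t) ^ n * (x * y) ^ n.choose 2 * (x ^ n + y ^ n) := by
  have h := det_thm11Matrix_eq_borderedDet x y t n 0
  rw [borderedDet_zero_left, signedPowerSum, if_neg hn.ne', Nat.cast_zero] at h
  have hs : (-1 : R) ^ n * (-1) ^ n = 1 := by rw [← mul_pow]; simp
  rw [h]
  linear_combination (1 + t) ^ n * (x * y) ^ n.choose 2 * (x ^ n + y ^ n) * hs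

end Evaluations

/-- Theorem 11: evaluation of `det_{0≤i,j≤n−1}(P_{j+1}(i,k) + t(xy)^i P_{j+1}(−i,k))`.
Hypotheses like `n = 2kn₁−1` are stated additively (`n + 1 = 2kn₁`); the sign
`(−1)^{k(n₁−1)−1}` is written `(−1)^{k(n₁−1)+1}` (same parity), and the exponent
`kn₁(2kn₁−k−3)+k` (a nonnegative integer whose subexpression `2kn₁−k−3` may be
negative) is computed in `ℤ` and converted by `toNat`. -/
theorem det_thm11Matrix {R : Type*} [CommRing R] (x y t : R) (n : ℕ) (hn : 0 < n) :
    (∀ k : ℕ, 2 ≤ k →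
      (∀ n₁ : ℕ, 0 < n₁ → n + 1 = 2 * k * n₁ →
        (thm11Matrix x y t n (k : ℤ)).det =
          (-1 : R) ^ (k * (n₁ - 1) + 1) * (1 + t) * t ^ (k * n₁ - 2) *
            (x * y) ^ ((k * n₁ * (2 * k * n₁ - k - 3) + k : ℤ)).toNat *
            ppolyt x y t (n - k + 2) k) ∧
      (∀ n₁ : ℕ, 0 < n₁ → n + k = 2 * k * n₁ + 1 →
        (thm11Matrix x y t n (k : ℤ)).det =
          (-1 : R) ^ (k * n₁ + Nat.choose k 2) * (1 + t) * t ^ (k * (n₁ - 1)) *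
            (x * y) ^ (k * (n₁ - 1) * (2 * k * n₁ - k + 1)) * ppolyt x y t n k) ∧
      (∀ n₁ : ℕ, 0 < n₁ → n + k = 2 * k * n₁ →
        (thm11Matrix x y t n (k : ℤ)).det =
          (-1 : R) ^ (k * n₁ + Nat.choose (k + 1) 2) * (1 + t) * t ^ (k * (n₁ - 1)) *
            (x * y) ^ (k * (n₁ - 1) * (2 * k * n₁ - k - 1)) * ppolyt x y t (n - k) k) ∧
      (∀ n₁ : ℕ, 0 < n₁ → n = 2 * k * n₁ →
        (thm11Matrix x y t n (k : ℤ)).det =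
          (-1 : R) ^ (k * n₁) * (1 + t) * t ^ (k * n₁ - 1) *
            (x * y) ^ (k * n₁ * (2 * k * n₁ - k - 1)) * ppolyt x y t n k) ∧
      (n % (2 * k) ≠ 0 ∧ n % (2 * k) ≠ k ∧ n % (2 * k) ≠ k + 1 ∧ n % (2 * k) ≠ 2 * k - 1 →
        (thm11Matrix x y t n (k : ℤ)).det = 0)) ∧
    ((∀ n₁ : ℕ, 0 < n₁ → n + 1 = 2 * n₁ →
        (thm11Matrix x y t n (1 : ℤ)).det =
          (-1 : R) ^ (n₁ + 1) * (1 + t) * t ^ (n₁ - 1) *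
            (x * y) ^ (2 * (n₁ - 1) ^ 2) * ppolyt x y t (n - 1) 1) ∧
      (∀ n₁ : ℕ, 0 < n₁ → n = 2 * n₁ →
        (thm11Matrix x y t n (1 : ℤ)).det =
          (-1 : R) ^ n₁ * (1 + t) * t ^ (n₁ - 1) *
            (x * y) ^ (2 * n₁ * (n₁ - 1)) * ppolyt x y t n 1)) ∧
    (thm11Matrix x y t n (0 : ℤ)).det =
      (1 + t) ^ n * (x * y) ^ Nat.choose n 2 * (x ^ n + y ^ n) := by
  refine ⟨fun k hk => ?_, ⟨?_, ?_⟩, det_thm11Matrix_zero x y t hn⟩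
  · obtain ⟨k, rfl⟩ := Nat.exists_eq_add_of_le' hk
    refine ⟨?_, ?_, ?_, ?_, ?_⟩
    · intro n₁ hn₁ h
      obtain ⟨N, rfl⟩ := Nat.exists_eq_add_of_le' hn₁
      obtain rfl : n = 2 * k + 3 + 2 * (k + 2) * N :=
        Nat.add_right_cancel (h.trans (by ring))
      have hN : ∃ a, a + N * (k + 2) * (k + 3) =
          N * (k + 2) * (2 * (2 * k + 3) + 2 * (k + 2) * N) :=
        ⟨N * (k + 2) * (3 * k + 3 + 2 * (k + 2) * N), by ring⟩
      obtain ⟨a, ha⟩ := hN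
      rw [det_thm11Matrix_of_eq_two_mul_sub_one x y t k N a ha, Nat.add_sub_cancel,
        show (k + 2) * (N + 1) - 2 = (k + 2) * N + k by
          rw [show (k + 2) * (N + 1) = (k + 2) * N + k + 2 by ring, Nat.add_sub_cancel],
        show 2 * k + 3 + 2 * (k + 2) * N - (k + 2) + 2 = (k + 2) * (2 * N + 1) + 1 by
          rw [show 2 * k + 3 + 2 * (k + 2) * N = k + 1 + 2 * (k + 2) * N + (k + 2) by ring,
            Nat.add_sub_cancel]
          ring]
      have hexp : (((k + 2 : ℕ) : ℤ) * ((N + 1 : ℕ) : ℤ) *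
          (2 * ((k + 2 : ℕ) : ℤ) * ((N + 1 : ℕ) : ℤ) - ((k + 2 : ℕ) : ℤ) - 3) +
          ((k + 2 : ℕ) : ℤ)).toNat = a + k * (k + 2) := by
        rw [← Int.toNat_natCast (a + k * (k + 2))]
        congr 1
        have ha' := congrArg (Nat.cast : ℕ → ℤ) ha
        push_cast at ha' ⊢
        linear_combination -ha'
      rw [hexp]
      push_cast
      ring
    · intro n₁ hn₁ h
      obtain ⟨N, rfl⟩ := Nat.exists_eq_add_of_le' hn₁
      obtain rfl : n = k + 3 + 2 * (k + 2) * N :=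
        Nat.add_right_cancel (h.trans (by ring))
      rw [det_thm11Matrix_of_eq_two_mul_add_succ x y t k N
          ((k + 2) * N * (2 * (k + 2) * N + k + 3)) (by ring), Nat.add_sub_cancel,
        show 2 * (k + 2) * (N + 1) - (k + 2) + 1 = 2 * (k + 2) * N + k + 3 by
          rw [show 2 * (k + 2) * (N + 1) = 2 * (k + 2) * N + k + 2 + (k + 2) by ring,
            Nat.add_sub_cancel]]
      push_cast
      ring
    · intro n₁ hn₁ h
      obtain ⟨N, rfl⟩ := Nat.exists_eq_add_of_le' hn₁
      obtain rfl : n = k + 1 + 1 + 2 * (k + 1 + 1) * N :=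
        Nat.add_right_cancel (h.trans (by ring))
      have hsign : (-1 : R) ^ ((k + 1 + 1) * N + (k + 1 + 1).choose 2) =
          (-1) ^ ((k + 2) * (N + 1) + (k + 2 + 1).choose 2) := by
        rw [Nat.choose_succ_succ' (k + 2) 1, Nat.choose_one_right,
          show (k + 2) * (N + 1) + (k + 2 + (k + 2).choose 2) =
            (k + 2) * N + (k + 2).choose 2 + 2 * (k + 2) by ring, pow_add _ _ (2 * (k + 2)),
          Even.neg_one_pow (even_two_mul (k + 2)), mul_one]
      rw [det_thm11Matrix_of_eq_two_mul_add_self x y t (k + 1) N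
          ((k + 2) * N * (2 * (k + 2) * N + k + 1)) (by ring), Nat.add_sub_cancel,
        show 2 * (k + 2) * (N + 1) - (k + 2) - 1 = 2 * (k + 2) * N + k + 1 by
          rw [show 2 * (k + 2) * (N + 1) = 2 * (k + 2) * N + k + 1 + 1 + (k + 2) by ring,
            Nat.add_sub_cancel, Nat.add_sub_cancel], ← hsign,
        show k + 1 + 1 + 2 * (k + 1 + 1) * N - (k + 2) = 2 * (k + 1 + 1) * N by
          rw [add_comm, Nat.add_sub_cancel]]
      push_cast
      ring
    · intro n₁ hn₁ h
      obtain ⟨N, rfl⟩ := Nat.exists_eq_add_of_le' hn₁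
      obtain rfl : n = 2 * (k + 1 + 1) * (N + 1) := h
      rw [det_thm11Matrix_of_eq_two_mul x y t (k + 1) N
          ((k + 2) * (N + 1) * (2 * (k + 2) * N + k + 1)) (by ring),
        show 2 * (k + 2) * (N + 1) - (k + 2) - 1 = 2 * (k + 2) * N + k + 1 by
          rw [show 2 * (k + 2) * (N + 1) = 2 * (k + 2) * N + k + 1 + 1 + (k + 2) by ring,
            Nat.add_sub_cancel, Nat.add_sub_cancel]]
      push_cast
      rfl
    · rintro ⟨h0, h1, h2, h3⟩
      exact det_thm11Matrix_eq_zero x y t (k + 1) n h0 h1 h2 fun h => h3 (h.trans (by omega))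
  · intro n₁ hn₁ h
    obtain ⟨N, rfl⟩ := Nat.exists_eq_add_of_le' hn₁
    obtain rfl : n = 0 + 1 + 2 * (0 + 1) * N := by omega
    have key := det_thm11Matrix_of_eq_two_mul_add_self x y t 0 N (2 * N ^ 2) (by ring)
    rw [Nat.add_sub_cancel, show 0 + 1 + 2 * (0 + 1) * N - 1 = 2 * (0 + 1) * N by omega,
      pow_add (-1 : R) (N + 1) 1]
    simpa [pow_succ] using key
  · intro n₁ hn₁ h
    obtain ⟨N, rfl⟩ := Nat.exists_eq_add_of_le' hn₁
    obtain rfl : n = 2 * (0 + 1) * (N + 1) := by omega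
    have key := det_thm11Matrix_of_eq_two_mul x y t 0 N (2 * (N + 1) * N) (by ring)
    simpa using key
end

section
/- For all positive integers n and nonnegative integers k, the n×n determinant over ℚ with (i,j)-entry (2k+1)/(i+j+k+1)·C(2i+2j, i+j+k), for 0 ≤ i, j ≤ n−1, equals (−1)^{kn₁+C(k,2)} if n = n₁(2k+1)−k for a positive integer n₁; equals (−1)^{kn₁} if n = n₁(2k+1) for a positive integer n₁; and equals 0 if n is congruent to neither 0 nor k+1 modulo 2k+1. -/
open Polynomial

/-- The ballot number `C(2m, m+k) - C(2m, m+k+1)`. -/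
def ballot (m k : ℕ) : ℚ := (2 * m).choose (m + k) - (2 * m).choose (m + k + 1)

theorem ballot_eq (m k : ℕ) :
    ((2 * k + 1 : ℚ) / ((m + k + 1 : ℕ) : ℚ)) * ((2 * m).choose (m + k) : ℚ) = ballot m k := by
  have h := Nat.choose_succ_right_eq (2 * m) (m + k)
  have hz : ((m + k + 1 : ℕ) : ℚ) ≠ 0 := by positivity
  rw [ballot, div_mul_eq_mul_div, div_eq_iff hz]
  rcases le_or_gt k m with hk | hk
  · obtain ⟨d, rfl⟩ := Nat.exists_eq_add_of_le hk
    rw [show 2 * (k + d) - (k + d + k) = d by omega] at h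
    have h' : ((2 * (k + d)).choose (k + d + k + 1) : ℚ) * (k + d + k + 1) =
      (2 * (k + d)).choose (k + d + k) * d := by exact_mod_cast h
    push_cast at h' ⊢
    linear_combination h'
  · rw [Nat.choose_eq_zero_of_lt (by omega), Nat.choose_eq_zero_of_lt (by omega)]
    simp

theorem ballot_eq_zero {m k : ℕ} (h : m < k) : ballot m k = 0 := by
  rw [ballot, Nat.choose_eq_zero_of_lt (by omega), Nat.choose_eq_zero_of_lt (by omega)]
  simp

theorem ballot_self (m : ℕ) : ballot m m = 1 := by
  rw [ballot, ← two_mul, Nat.choose_self, Nat.choose_eq_zero_of_lt (by omega)]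
  simp

theorem ballot_succ_succ (m k : ℕ) :
    ballot (m + 1) (k + 1) = ballot m k + 2 * ballot m (k + 1) + ballot m (k + 2) := by
  have key (j : ℕ) : (2 * (m + 1)).choose (j + 2) =
      (2 * m).choose j + 2 * (2 * m).choose (j + 1) + (2 * m).choose (j + 2) := by
    rw [show 2 * (m + 1) = 2 * m + 1 + 1 by ring, Nat.choose_succ_succ', Nat.choose_succ_succ',
      Nat.choose_succ_succ']
    ring
  simp only [ballot]
  rw [show m + 1 + (k + 1) = m + k + 2 by ring, show m + k + 2 + 1 = m + k + 1 + 2 by ring,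
    key, key]
  push_cast
  simp only [← add_assoc]
  ring

theorem ballot_succ_zero (m : ℕ) : ballot (m + 1) 0 = ballot m 0 + ballot m 1 := by
  have h1 : (2 * (m + 1)).choose (m + 1) = 2 * ((2 * m).choose m + (2 * m).choose (m + 1)) := by
    rw [show 2 * (m + 1) = 2 * m + 1 + 1 by ring, Nat.choose_succ_succ',
      ← Nat.choose_symm_half, Nat.choose_succ_succ']
    ring
  have h2 : (2 * (m + 1)).choose (m + 2) =
      (2 * m).choose m + 2 * (2 * m).choose (m + 1) + (2 * m).choose (m + 2) := by
    rw [show 2 * (m + 1) = 2 * m + 1 + 1 by ring, Nat.choose_succ_succ', Nat.choose_succ_succ',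
      Nat.choose_succ_succ']
    ring
  simp only [ballot, add_zero]
  rw [h1, add_assoc m 1 1, h2]
  push_cast
  ring

/-- The monic orthogonal polynomials of the Catalan moment sequence. -/
noncomputable def catalanPoly : ℕ → ℚ[X]
  | 0 => 1
  | 1 => X - 1
  | j + 2 => (X - 2) * catalanPoly (j + 1) - catalanPoly j

theorem catalanPoly_add_two (j : ℕ) :
    catalanPoly (j + 2) = (X - 2) * catalanPoly (j + 1) - catalanPoly j := rfl

theorem catalanPoly_monic_natDegree (j : ℕ) :
    (catalanPoly j).Monic ∧ (catalanPoly j).natDegree = j := by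
  induction j using Nat.strong_induction_on with
  | _ j ih =>
    match j with
    | 0 => simp [catalanPoly]
    | 1 =>
      rw [catalanPoly, ← C_1]
      exact ⟨monic_X_sub_C _, natDegree_X_sub_C _⟩
    | j + 2 =>
      obtain ⟨m1, d1⟩ := ih (j + 1) (by omega)
      obtain ⟨m0, d0⟩ := ih j (by omega)
      have hX : (X - 2 : ℚ[X]).Monic := monic_X_sub_C 2
      have dX : (X - 2 : ℚ[X]).natDegree = 1 := natDegree_X_sub_C 2
      have hd : ((X - 2) * catalanPoly (j + 1)).natDegree = j + 2 := by
        rw [hX.natDegree_mul m1, dX, d1]; ring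
      have hlt : (catalanPoly j).degree < ((X - 2) * catalanPoly (j + 1)).degree :=
        degree_lt_degree (by omega)
      rw [catalanPoly_add_two]
      refine ⟨(hX.mul m1).sub_of_left hlt, ?_⟩
      rw [natDegree_sub_eq_left_of_natDegree_lt (by omega), hd]

theorem catalanPoly_monic (j : ℕ) : (catalanPoly j).Monic := (catalanPoly_monic_natDegree j).1

theorem natDegree_catalanPoly (j : ℕ) : (catalanPoly j).natDegree = j :=
  (catalanPoly_monic_natDegree j).2

/-- The linear functional on `ℚ[X]` whose moments are the Catalan numbers. -/
noncomputable def catalanFunctional : ℚ[X] →ₗ[ℚ] ℚ :=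
  (basisMonomials ℚ).constr ℚ fun m => ballot m 0

theorem catalanFunctional_X_pow_mul (k m : ℕ) :
    catalanFunctional (X ^ m * catalanPoly k) = ballot m k := by
  have h0 (m : ℕ) : catalanFunctional (X ^ m) = ballot m 0 := by
    have h := (basisMonomials ℚ).constr_basis ℚ (fun m => ballot m 0) m
    rwa [coe_basisMonomials, show (fun s => monomial s (1 : ℚ)) m = X ^ m from
      monomial_one_right_eq_X_pow m] at h
  induction k using Nat.strong_induction_on generalizing m with
  | _ k ih =>
    match k with
    | 0 => simp [catalanPoly, h0]
    | 1 =>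
      rw [catalanPoly, mul_sub, ← pow_succ, mul_one, map_sub, h0, h0, ballot_succ_zero]
      ring
    | k + 2 =>
      have e : (X : ℚ[X]) ^ m * catalanPoly (k + 2) = X ^ (m + 1) * catalanPoly (k + 1)
          - (2 : ℚ) • (X ^ m * catalanPoly (k + 1)) - X ^ m * catalanPoly k := by
        rw [catalanPoly_add_two, smul_eq_C_mul, show (C 2 : ℚ[X]) = 2 from rfl]
        ring
      rw [e, map_sub, map_sub, map_smul, ih _ (by omega), ih _ (by omega), ih _ (by omega),
        ballot_succ_succ, smul_eq_mul]
      ring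

theorem catalanFunctional_mul_of_natDegree_le {p : ℚ[X]} {j : ℕ} (hp : p.natDegree ≤ j) :
    catalanFunctional (p * catalanPoly j) = p.coeff j := by
  conv_lhs => rw [p.as_sum_range_C_mul_X_pow' (Nat.lt_succ_of_le hp)]
  simp only [Finset.sum_mul, map_sum, ← smul_eq_C_mul, smul_mul_assoc, map_smul,
    catalanFunctional_X_pow_mul, smul_eq_mul]
  rw [Finset.sum_range_succ, ballot_self, Finset.sum_eq_zero, zero_add, mul_one]
  intro i hi
  rw [ballot_eq_zero (Finset.mem_range.1 hi), mul_zero]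

theorem catalanFunctional_mul (i j : ℕ) :
    catalanFunctional (catalanPoly i * catalanPoly j) = if i = j then 1 else 0 := by
  wlog h : i ≤ j generalizing i j
  · rw [mul_comm, this j i (by omega)]
    simp only [eq_comm]
  rw [catalanFunctional_mul_of_natDegree_le ((natDegree_catalanPoly i).trans_le h)]
  split_ifs with hij
  · subst hij
    have := (catalanPoly_monic i).coeff_natDegree
    rwa [natDegree_catalanPoly] at this
  · exact coeff_eq_zero_of_natDegree_lt (by rw [natDegree_catalanPoly]; omega)

/-- Replacing the monomials by monic polynomials does not change a Hankel determinant. -/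
theorem det_functional_monic {R : Type*} [CommRing R] (φ : R[X] →ₗ[R] R) {n : ℕ}
    (p q : Fin n → R[X])
    (hp : ∀ i, (p i).natDegree = i) (hpm : ∀ i, (p i).Monic)
    (hq : ∀ i, (q i).natDegree = i) (hqm : ∀ i, (q i).Monic) :
    (Matrix.of fun i j => φ (p i * q j)).det =
      (Matrix.of fun i j : Fin n => φ (X ^ (i : ℕ) * X ^ (j : ℕ))).det := by
  have hP := Matrix.det_matrixOfPolynomials p hp hpm
  have hQ := Matrix.det_matrixOfPolynomials q hq hqm
  have key : (Matrix.of fun i j => φ (p i * q j)) =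
      (Matrix.of fun i j : Fin n => (p j).coeff i).transpose *
      (Matrix.of fun i j : Fin n => φ (X ^ (i : ℕ) * X ^ (j : ℕ))) *
      (Matrix.of fun i j : Fin n => (q j).coeff i) := by
    ext i j
    have exp (r : R[X]) (i : Fin n) (h : r.natDegree = i) :
        r = ∑ l : Fin n, C (r.coeff l) * X ^ (l : ℕ) := by
      rw [Fin.sum_univ_eq_sum_range (fun l => C (r.coeff l) * X ^ l) n]
      exact r.as_sum_range_C_mul_X_pow' (h.trans_lt i.2)
    simp only [Matrix.of_apply, Matrix.mul_apply, Matrix.transpose_apply]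
    conv_lhs => rw [exp (p i) i (hp i), exp (q j) j (hq j)]
    rw [Finset.mul_sum, map_sum]
    refine Finset.sum_congr rfl fun m _ => ?_
    rw [Finset.sum_mul, map_sum, Finset.sum_mul]
    refine Finset.sum_congr rfl fun l _ => ?_
    rw [show C ((p i).coeff l) * X ^ (l : ℕ) * (C ((q j).coeff m) * X ^ (m : ℕ)) =
      C ((p i).coeff l * (q j).coeff m) * (X ^ (l : ℕ) * X ^ (m : ℕ)) by rw [C_mul]; ring,
      ← smul_eq_C_mul, map_smul, smul_eq_mul]
    ring
  rw [key, Matrix.det_mul, Matrix.det_mul, Matrix.det_transpose, hP, hQ, one_mul, mul_one]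

theorem catalanPoly_dvd_add (s a : ℕ) :
    catalanPoly (a + s) ∣ catalanPoly (a + s + s) + catalanPoly a := by
  suffices h : ∀ s a k, k = a + s → catalanPoly k ∣ catalanPoly (k + s) + catalanPoly a from
    h s a _ rfl
  intro s
  induction s using Nat.strong_induction_on with
  | _ s ih =>
    intro a k hk
    match s with
    | 0 =>
      subst hk
      exact (dvd_refl _).add (dvd_refl _)
    | 1 =>
      subst hk
      refine ⟨X - 2, ?_⟩
      rw [add_assoc, catalanPoly_add_two]
      ring
    | s + 2 =>
      have h1 := ih (s + 1) (by omega) (a + 1) k (by omega)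
      have h0 := ih s (by omega) (a + 2) k (by omega)
      have e : catalanPoly (k + (s + 2)) + catalanPoly a =
          (X - 2) * (catalanPoly (k + (s + 1)) + catalanPoly (a + 1)) -
          (catalanPoly (k + s) + catalanPoly (a + 2)) := by
        rw [← add_assoc k s 2, catalanPoly_add_two, catalanPoly_add_two a, add_assoc k s 1]
        ring
      rw [e]
      exact (h1.mul_left _).sub h0

theorem catalanPoly_dvd_sub (k j : ℕ) :
    catalanPoly k ∣ catalanPoly (j + (2 * k + 1)) - catalanPoly j := by
  rcases k with _ | k
  · exact one_dvd _
  have ha := catalanPoly_dvd_add (k + 1) 0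
  have hb := catalanPoly_dvd_add k 1
  rw [show 0 + (k + 1) = k + 1 by ring, show k + 1 + (k + 1) = 2 * k + 2 by ring] at ha
  rw [show 1 + k = k + 1 by ring, show k + 1 + k = 2 * k + 1 by ring] at hb
  induction j using Nat.strong_induction_on with
  | _ j ih =>
    match j with
    | 0 =>
      have e : catalanPoly (0 + (2 * (k + 1) + 1)) - catalanPoly 0 =
          (X - 2) * (catalanPoly (2 * k + 2) + catalanPoly 0) -
            (catalanPoly (2 * k + 1) + catalanPoly 1) := by
        rw [show 0 + (2 * (k + 1) + 1) = 2 * k + 1 + 2 by ring, catalanPoly_add_two]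
        simp only [catalanPoly]
        ring
      rw [e]
      exact (ha.mul_left _).sub hb
    | 1 =>
      have e : catalanPoly (1 + (2 * (k + 1) + 1)) - catalanPoly 1 =
          (X - 2) * (catalanPoly (0 + (2 * (k + 1) + 1)) - catalanPoly 0) -
            (catalanPoly (2 * k + 2) + catalanPoly 0) := by
        rw [show 1 + (2 * (k + 1) + 1) = 2 * k + 2 + 2 by ring, catalanPoly_add_two,
          show 0 + (2 * (k + 1) + 1) = 2 * k + 2 + 1 by ring]
        simp only [catalanPoly]
        ring
      rw [e]
      exact ((ih 0 (by omega)).mul_left _).sub ha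
    | j + 2 =>
      have e : catalanPoly (j + 2 + (2 * (k + 1) + 1)) - catalanPoly (j + 2) =
          (X - 2) * (catalanPoly (j + 1 + (2 * (k + 1) + 1)) - catalanPoly (j + 1)) -
            (catalanPoly (j + (2 * (k + 1) + 1)) - catalanPoly j) := by
        rw [show j + 2 + (2 * (k + 1) + 1) = j + (2 * (k + 1) + 1) + 2 by ring,
          catalanPoly_add_two, catalanPoly_add_two j,
          show j + 1 + (2 * (k + 1) + 1) = j + (2 * (k + 1) + 1) + 1 by ring]
        ring
      rw [e]
      exact ((ih (j + 1) (by omega)).mul_left _).sub (ih j (by omega))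

theorem catalanPoly_dvd_sub_mul (k j m : ℕ) :
    catalanPoly k ∣ catalanPoly ((2 * k + 1) * m + j) - catalanPoly j := by
  induction m with
  | zero => simp
  | succ m ih =>
    have h := (catalanPoly_dvd_sub k ((2 * k + 1) * m + j)).add ih
    rwa [sub_add_sub_cancel,
      show (2 * k + 1) * m + j + (2 * k + 1) = (2 * k + 1) * (m + 1) + j by ring] at h

/-- The index of the lower term of `sparsePoly k j`. -/
def lowerIndex (k j : ℕ) : ℕ :=
  if j % (2 * k + 1) ≤ k then j - j % (2 * k + 1) + (k - j % (2 * k + 1)) else j - (k + 1)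

/-- The coefficient of the lower term of `sparsePoly k j`. -/
def lowerCoeff (k j : ℕ) : ℚ :=
  if j % (2 * k + 1) = 0 then 0 else if j % (2 * k + 1) ≤ k then 1 else -1

/-- A multiple of `catalanPoly k` of degree `j + k` with at most two terms in the
basis `catalanPoly`. -/
noncomputable def sparsePoly (k j : ℕ) : ℚ[X] :=
  catalanPoly (j + k) + C (lowerCoeff k j) * catalanPoly (lowerIndex k j)

theorem catalanPoly_dvd_sparsePoly (k j : ℕ) : catalanPoly k ∣ sparsePoly k j := by
  have hj := Nat.div_add_mod j (2 * k + 1)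
  have hle := Nat.mod_le j (2 * k + 1)
  rw [sparsePoly, lowerCoeff, lowerIndex]
  generalize hs : j % (2 * k + 1) = s at *
  generalize j / (2 * k + 1) = m at *
  split_ifs with h0 h1 h1
  · have := (catalanPoly_dvd_sub_mul k k m).add (dvd_refl _)
    rw [sub_add_cancel] at this
    rw [C_0, zero_mul, add_zero]
    rwa [show j = (2 * k + 1) * m by omega]
  · omega
  · have h2 := catalanPoly_dvd_sub_mul k (k + s) m
    have h3 := catalanPoly_dvd_sub_mul k (k - s) m
    have h4 := catalanPoly_dvd_add s (k - s)
    rw [Nat.sub_add_cancel h1] at h4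
    have h5 := (h2.add h3).add h4
    rw [show j - s + (k - s) = (2 * k + 1) * m + (k - s) by omega,
      show j + k = (2 * k + 1) * m + (k + s) by omega, C_1, one_mul]
    convert! h5 using 1
    ring
  · have h2 := catalanPoly_dvd_sub k (j - (k + 1))
    rw [show j - (k + 1) + (2 * k + 1) = j + k by omega] at h2
    rw [C_neg, C_1, neg_one_mul, ← sub_eq_add_neg]
    exact h2

theorem sparsePoly_monic_natDegree (k j : ℕ) :
    (sparsePoly k j).Monic ∧ (sparsePoly k j).natDegree = j + k := by
  have hlt : (C (lowerCoeff k j) * catalanPoly (lowerIndex k j)).degree <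
      (catalanPoly (j + k)).degree := by
    by_cases h0 : j % (2 * k + 1) = 0
    · rw [lowerCoeff, if_pos h0, C_0, zero_mul, degree_zero, bot_lt_iff_ne_bot, Ne,
        degree_eq_bot]
      exact (catalanPoly_monic _).ne_zero
    · have hle := Nat.mod_le j (2 * k + 1)
      refine (smul_eq_C_mul (R := ℚ) (lowerCoeff k j) ▸ degree_smul_le _ _).trans_lt (degree_lt_degree ?_)
      rw [natDegree_catalanPoly, natDegree_catalanPoly, lowerIndex]
      split_ifs <;> omega
  refine ⟨(catalanPoly_monic _).add_of_left hlt, ?_⟩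
  rw [sparsePoly, natDegree_add_eq_left_of_degree_lt hlt, natDegree_catalanPoly]

theorem exists_monic_mul_eq_sparsePoly (k j : ℕ) :
    ∃ q : ℚ[X], q.natDegree = j ∧ q.Monic ∧ sparsePoly k j = q * catalanPoly k := by
  obtain ⟨q, hq⟩ := catalanPoly_dvd_sparsePoly k j
  obtain ⟨hm, hd⟩ := sparsePoly_monic_natDegree k j
  rw [hq] at hm hd
  have hqm := (catalanPoly_monic k).of_mul_monic_left hm
  rw [(catalanPoly_monic k).natDegree_mul hqm, natDegree_catalanPoly] at hd
  exact ⟨q, by omega, hqm, hq.trans (mul_comm _ _)⟩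

/-- The coefficient of `catalanPoly i` in `sparsePoly k j`. -/
def sparseEntry (k i j : ℕ) : ℚ :=
  (if i = j + k then 1 else 0) + lowerCoeff k j * (if i = lowerIndex k j then 1 else 0)

/-- The leading `n × n` truncation of `sparseEntry k`. -/
def sparseMatrix (k n : ℕ) : Matrix (Fin n) (Fin n) ℚ :=
  Matrix.of fun i j => sparseEntry k i j

theorem catalanFunctional_mul_sparsePoly (k i j : ℕ) :
    catalanFunctional (catalanPoly i * sparsePoly k j) = sparseEntry k i j := by
  rw [sparsePoly, mul_add, mul_left_comm, ← smul_eq_C_mul, map_add, map_smul,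
    catalanFunctional_mul, catalanFunctional_mul, smul_eq_mul, sparseEntry]

theorem det_hankel_ballot_eq_sparse (k n : ℕ) :
    (Matrix.of fun i j : Fin n => ballot (i + j) k).det = (sparseMatrix k n).det := by
  choose q hd hm hq using fun j : Fin n => exists_monic_mul_eq_sparsePoly k j
  have h := det_functional_monic
    (catalanFunctional ∘ₗ LinearMap.mulRight ℚ (catalanPoly k)) (fun i : Fin n => catalanPoly i) q
    (fun i => natDegree_catalanPoly i) (fun i => catalanPoly_monic i) hd hm
  simp only [LinearMap.comp_apply, LinearMap.mulRight_apply, mul_assoc, ← hq,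
    catalanFunctional_mul_sparsePoly] at h
  simp only [← mul_assoc, ← pow_add, catalanFunctional_X_pow_mul] at h
  exact h.symm

theorem sparseEntry_add_add (k i j : ℕ) :
    sparseEntry k (i + (2 * k + 1)) (j + (2 * k + 1)) = sparseEntry k i j := by
  have hle := Nat.mod_le j (2 * k + 1)
  have hL : lowerIndex k (j + (2 * k + 1)) = lowerIndex k j + (2 * k + 1) := by
    rw [lowerIndex, lowerIndex, Nat.add_mod_right]
    split_ifs <;> omega
  have hC : lowerCoeff k (j + (2 * k + 1)) = lowerCoeff k j := by
    rw [lowerCoeff, lowerCoeff, Nat.add_mod_right]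
  simp only [sparseEntry, hL, hC, add_right_comm j, Nat.add_right_cancel_iff]

theorem sparseEntry_add_right {k i : ℕ} (hi : i < 2 * k + 1) (j : ℕ) :
    sparseEntry k i (j + (2 * k + 1)) = 0 := by
  have hle := Nat.mod_le j (2 * k + 1)
  rw [sparseEntry, lowerIndex, Nat.add_mod_right, if_neg (by omega), if_neg, mul_zero, add_zero]
  split_ifs <;> omega

theorem det_sparseMatrix_add (k n : ℕ) :
    (sparseMatrix k ((2 * k + 1) + n)).det =
      (sparseMatrix k (2 * k + 1)).det * (sparseMatrix k n).det := by
  rw [← Matrix.det_submatrix_equiv_self finSumFinEquiv (sparseMatrix k ((2 * k + 1) + n)),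
    ← Matrix.det_fromBlocks_zero₁₂ _
      (Matrix.of fun (i : Fin n) (j : Fin (2 * k + 1)) => sparseEntry k ((2 * k + 1) + i) j)]
  congr 1
  ext i j
  rcases i with i | i <;> rcases j with j | j <;>
    simp only [sparseMatrix, Matrix.submatrix_apply, Matrix.of_apply, Matrix.fromBlocks_apply₁₁,
      Matrix.fromBlocks_apply₁₂, Matrix.fromBlocks_apply₂₁, Matrix.fromBlocks_apply₂₂,
      finSumFinEquiv_apply_left, finSumFinEquiv_apply_right, Fin.val_castAdd, Fin.val_natAdd,
      Matrix.zero_apply]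
  · rw [add_comm (2 * k + 1), sparseEntry_add_right i.2]
  · rw [add_comm (2 * k + 1), add_comm (2 * k + 1), sparseEntry_add_add]

theorem sign_addRight_fin (k c : ℕ) :
    Equiv.Perm.sign (Equiv.addRight (Fin.ofNat (2 * k + 1) c)) = 1 := by
  set σ := Equiv.addRight (Fin.ofNat (2 * k + 1) c)
  have h : σ ^ (2 * k + 1) = 1 := by
    have key (n : ℕ) (x : Fin (2 * k + 1)) : (σ ^ n) x = x + n • Fin.ofNat (2 * k + 1) c := by
      induction n with
      | zero => simp
      | succ n ih => rw [pow_succ', Equiv.Perm.mul_apply, ih, succ_nsmul, ← add_assoc]; rfl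
    ext x
    have hc := card_nsmul_eq_zero (x := Fin.ofNat (2 * k + 1) c)
    rw [Fintype.card_fin] at hc
    rw [key, hc, add_zero, Equiv.Perm.one_apply]
  have h2 : Equiv.Perm.sign σ ^ (2 * k + 1) = 1 := by rw [← map_pow, h, map_one]
  rcases Int.units_eq_one_or (Equiv.Perm.sign σ) with h3 | h3
  · exact h3
  · rw [h3, Odd.neg_one_pow ⟨k, rfl⟩] at h2
    exact absurd h2 (by decide)

theorem det_sparseMatrix_period (k : ℕ) : (sparseMatrix k (2 * k + 1)).det = (-1) ^ k := by
  have h := Matrix.det_permute (Equiv.addRight (Fin.ofNat (2 * k + 1) k))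
    (sparseMatrix k (2 * k + 1))
  rw [sign_addRight_fin, Units.val_one, Int.cast_one, one_mul] at h
  have entry (i j : Fin (2 * k + 1)) (hij : i ≤ j) :
      (sparseMatrix k (2 * k + 1)).submatrix (Equiv.addRight (Fin.ofNat (2 * k + 1) k)) id i j =
        if i = j then (if (j : ℕ) < k + 1 then 1 else -1) else 0 := by
    have hi := i.2
    have hj := j.2
    have hij' : (i : ℕ) ≤ j := hij
    have hval : ((Equiv.addRight (Fin.ofNat (2 * k + 1) k) i : Fin (2 * k + 1)) : ℕ) =
        if (i : ℕ) ≤ k then i + k else i - (k + 1) := by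
      simp only [Equiv.coe_addRight, Fin.val_add, Fin.ofNat, Nat.add_mod_mod]
      split_ifs with hik
      · exact Nat.mod_eq_of_lt (by omega)
      · rw [Nat.mod_eq_sub_mod (by omega), Nat.mod_eq_of_lt (by omega)]
        omega
    simp only [Matrix.submatrix_apply, sparseMatrix, Matrix.of_apply, id, hval, sparseEntry,
      lowerCoeff, lowerIndex, Nat.mod_eq_of_lt hj, Fin.ext_iff]
    split_ifs <;> first | omega | norm_num
  rw [← h, Matrix.det_of_isLowerTriangular]
  · rw [Finset.prod_congr rfl fun i _ => (entry i i le_rfl).trans (if_pos rfl),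
      Fin.prod_univ_eq_prod_range (fun j => if j < k + 1 then (1 : ℚ) else -1),
      show 2 * k + 1 = k + 1 + k by ring, Finset.prod_range_add,
      Finset.prod_congr rfl fun j hj => if_pos (Finset.mem_range.1 hj),
      Finset.prod_congr rfl fun j _ => if_neg (by omega)]
    simp
  · intro i j hij
    have hij' : i < j := hij
    rw [entry i j hij'.le, if_neg hij'.ne]

theorem det_antidiagonal (k : ℕ) :
    (Matrix.of fun i j : Fin (k + 1) => if (i : ℕ) + j = k then (1 : ℚ) else 0).det =
      (-1) ^ (k + k.choose 2) := by
  induction k with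
  | zero => simp
  | succ k ih =>
    rw [Matrix.det_succ_row_zero, Finset.sum_eq_single (Fin.last (k + 1))]
    · have e : (Matrix.of fun i j : Fin (k + 1 + 1) =>
          if (i : ℕ) + j = k + 1 then (1 : ℚ) else 0).submatrix Fin.succ
            (Fin.last (k + 1)).succAbove =
          Matrix.of fun i j : Fin (k + 1) => if (i : ℕ) + j = k then (1 : ℚ) else 0 := by
        ext i j
        simp only [Matrix.submatrix_apply, Matrix.of_apply, Fin.succAbove_last, Fin.val_succ,
          Fin.val_castSucc]
        congr 1
        exact propext (by omega)
      rw [e, ih, Nat.choose_succ_succ' k 1, Nat.choose_one_right]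
      simp [pow_add]
    · intro j _ hj
      have : (j : ℕ) ≠ k + 1 := fun h => hj (Fin.ext h)
      simp [this]
    · simp

theorem det_sparseMatrix_succ (k : ℕ) :
    (sparseMatrix k (k + 1)).det = (-1) ^ (k + k.choose 2) := by
  rw [← det_antidiagonal]
  congr 1
  ext i j
  have hi := i.2
  have hj := j.2
  simp only [sparseMatrix, Matrix.of_apply, sparseEntry, lowerCoeff, lowerIndex,
    Nat.mod_eq_of_lt (show (j : ℕ) < 2 * k + 1 by omega)]
  split_ifs <;> first | omega | norm_num

theorem det_sparseMatrix_eq_zero {k r : ℕ} (h0 : r ≠ 0) (hr : r < 2 * k + 1) (hk : r ≠ k + 1) :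
    (sparseMatrix k r).det = 0 := by
  rcases le_or_gt r k with h | h
  · refine Matrix.det_eq_zero_of_row_eq_zero ⟨0, Nat.pos_of_ne_zero h0⟩ fun j => ?_
    have hj := j.2
    simp only [sparseMatrix, Matrix.of_apply, sparseEntry, lowerCoeff, lowerIndex,
      Nat.mod_eq_of_lt (show (j : ℕ) < 2 * k + 1 by omega)]
    split_ifs <;> first | omega | norm_num
  · have h1 : k + 1 < r := by omega
    have hne : (⟨k, h⟩ : Fin r) ≠ ⟨k + 1, h1⟩ := by simp
    rw [← Matrix.det_updateCol_add_self _ hne]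
    refine Matrix.det_eq_zero_of_column_eq_zero ⟨k, h⟩ fun i => ?_
    have hi := i.2
    simp only [Matrix.updateCol_self, sparseMatrix, Matrix.of_apply, sparseEntry, lowerCoeff,
      lowerIndex, Nat.mod_eq_of_lt (show k < 2 * k + 1 by omega),
      Nat.mod_eq_of_lt (show k + 1 < 2 * k + 1 by omega)]
    split_ifs <;> first | omega | (exfalso; assumption) | norm_num

theorem det_sparseMatrix_mul_add (k m r : ℕ) :
    (sparseMatrix k (m * (2 * k + 1) + r)).det = (-1) ^ (k * m) * (sparseMatrix k r).det := by
  induction m with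
  | zero => rw [Nat.zero_mul, Nat.zero_add, mul_zero, pow_zero, one_mul]
  | succ m ih =>
    rw [show (m + 1) * (2 * k + 1) + r = (2 * k + 1) + (m * (2 * k + 1) + r) by ring,
      det_sparseMatrix_add, ih, det_sparseMatrix_period]
    ring

/-- Corollary 12: the determinant of the `n×n` matrix of ballot numbers
`(2k+1)/(i+j+k+1)·C(2i+2j, i+j+k)`, computed in `ℚ`.
The hypothesis `n = n₁(2k+1)−k` is stated additively as `n + k = n₁(2k+1)`. -/
theorem det_ballot_hankel (n : ℕ) (hn : 0 < n) (k : ℕ) :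
    (∀ n₁ : ℕ, 0 < n₁ → n + k = n₁ * (2 * k + 1) →
      Matrix.det (Matrix.of fun i j : Fin n =>
          ((2 * k + 1 : ℚ) / ((i.1 + j.1 + k + 1 : ℕ) : ℚ)) *
            ((2 * i.1 + 2 * j.1).choose (i.1 + j.1 + k) : ℚ)) =
        (-1 : ℚ) ^ (k * n₁ + Nat.choose k 2)) ∧
    (∀ n₁ : ℕ, 0 < n₁ → n = n₁ * (2 * k + 1) →
      Matrix.det (Matrix.of fun i j : Fin n =>
          ((2 * k + 1 : ℚ) / ((i.1 + j.1 + k + 1 : ℕ) : ℚ)) *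
            ((2 * i.1 + 2 * j.1).choose (i.1 + j.1 + k) : ℚ)) =
        (-1 : ℚ) ^ (k * n₁)) ∧
    (n % (2 * k + 1) ≠ 0 ∧ n % (2 * k + 1) ≠ (k + 1) % (2 * k + 1) →
      Matrix.det (Matrix.of fun i j : Fin n =>
          ((2 * k + 1 : ℚ) / ((i.1 + j.1 + k + 1 : ℕ) : ℚ)) *
            ((2 * i.1 + 2 * j.1).choose (i.1 + j.1 + k) : ℚ)) = 0) := by
  have hdet : Matrix.det (Matrix.of fun i j : Fin n =>
      ((2 * k + 1 : ℚ) / ((i.1 + j.1 + k + 1 : ℕ) : ℚ)) *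
        ((2 * i.1 + 2 * j.1).choose (i.1 + j.1 + k) : ℚ)) = (sparseMatrix k n).det := by
    simp only [← det_hankel_ballot_eq_sparse, ← mul_add, ballot_eq]
  rw [hdet]
  refine ⟨fun n₁ h₁ h => ?_, fun n₁ _ h => ?_, fun ⟨h, h'⟩ => ?_⟩
  · obtain ⟨m, rfl⟩ := Nat.exists_eq_succ_of_ne_zero h₁.ne'
    rw [Nat.succ_eq_add_one] at *
    rw [add_mul] at h
    rw [show n = m * (2 * k + 1) + (k + 1) by omega, det_sparseMatrix_mul_add,
      det_sparseMatrix_succ]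
    ring
  · rw [h, ← add_zero (n₁ * (2 * k + 1)), det_sparseMatrix_mul_add, Matrix.det_isEmpty, mul_one]
  · rw [← Nat.div_add_mod' n (2 * k + 1), det_sparseMatrix_mul_add, det_sparseMatrix_eq_zero h
      (Nat.mod_lt _ (by omega)), mul_zero]
    have hk : k ≠ 0 := by
      rintro rfl
      omega
    rwa [Nat.mod_eq_of_lt (show k + 1 < 2 * k + 1 by omega)] at h'
end
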